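/- arXiv:1004.1558 — 2 statements merged into one kernel-verified Lean document; each statement's English description precedes it below -/
import Mathlib

section
/- Fix real numbers δ, δ̄ and ν, μ > 0. Set ξ_ν(x) = √x·(cos(δ)·J_ν(x) − sin(δ)·Y_ν(x)) and ξ̄_μ(x) = √x·(cos(δ̄)·J_μ(x) − sin(δ̄)·Y_μ(x)), and let W(x) = ξ_ν(x)·ξ̄_μ′(x) − ξ_ν′(x)·ξ̄_μ(x) for x > 0. Then W(x) converges to (2/π)·sin(((μ − ν)/2)·π + δ − δ̄) as x → ∞. -/
open Real Filter Topology Set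

/-- Bessel function of the first kind of real order `ν`:
`J_ν(x) = ∑ ((−1)^m / (m! Γ(m+ν+1))) (x/2)^{2m+ν}` (with `1/Γ = 0` at nonpositive
integers, which agrees with Lean's `1/0 = 0` since `Real.Gamma` vanishes there). -/
noncomputable def besselJ (ν : ℝ) (x : ℝ) : ℝ :=
  ∑' m : ℕ, ((-1 : ℝ) ^ m / (m.factorial * Real.Gamma ((m : ℝ) + ν + 1))) *
    (x / 2) ^ (2 * (m : ℝ) + ν)

/-- Bessel function of the second kind, characterized as the limit
`(J_μ(x) cos(μπ) − J_{−μ}(x)) / sin(μπ) → Y_ν(x)` as `μ → ν` through non-integer reals. -/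
noncomputable def besselY (ν : ℝ) (x : ℝ) : ℝ :=
  limUnder (𝓝[{μ : ℝ | ∀ n : ℤ, μ ≠ (n : ℝ)}] ν)
    (fun μ : ℝ => (besselJ μ x * Real.cos (μ * π) - besselJ (-μ) x) / Real.sin (μ * π))

/-- The cylinder function `C_ν(x) = cos δ · J_ν(x) − sin δ · Y_ν(x)`. -/
noncomputable def cylinder (δ ν : ℝ) (x : ℝ) : ℝ :=
  Real.cos δ * besselJ ν x - Real.sin δ * besselY ν x

/-- One direction of the interlacing property: between any two consecutive zeros of `f`
in `I` there is exactly one zero of `g`. -/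
def InterlaceHalf (f g : ℝ → ℝ) (I : Set ℝ) : Prop :=
  ∀ x₁ ∈ I, ∀ x₂ ∈ I, x₁ < x₂ → f x₁ = 0 → f x₂ = 0 →
    (∀ x ∈ Set.Ioo x₁ x₂, f x ≠ 0) →
    ∃! x, x ∈ Set.Ioo x₁ x₂ ∧ g x = 0

/-- `f` and `g` have interlaced zeros on `I`. -/
def InterlacedOn (f g : ℝ → ℝ) (I : Set ℝ) : Prop :=
  InterlaceHalf f g I ∧ InterlaceHalf g f I

open MeasureTheory in
theorem bs_bound_integrable {b : ℝ} (hb : 0 < b) (c : ℝ) :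
    IntegrableOn (fun s : ℝ => Real.exp (-b * s) * (1 + s) ^ c) (Ioi 0) := by
  apply integrable_of_isBigO_exp_neg (b := b / 2) (by linarith)
  · apply ContinuousOn.mul (by fun_prop)
    apply ContinuousOn.rpow_const (by fun_prop)
    intro s hs
    left
    have : (0:ℝ) ≤ s := hs
    linarith
  · have h1 := (isLittleO_exp_neg_mul_rpow_atTop (a := b / 2) (by linarith) (-c)).isBigO
    have h2 : Tendsto (fun s : ℝ => 1 + s) atTop atTop := tendsto_atTop_add_const_left _ _ tendsto_id
    have h3 := h1.comp_tendsto h2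
    have h4 : (fun s : ℝ => Real.exp (-b * s) * (1 + s) ^ c) =ᶠ[atTop]
        fun s => Real.exp (b/2) * Real.exp (-(b/2) * s) * (Real.exp (-(b/2) * (1 + s)) * (1 + s) ^ c) := by
      filter_upwards with s
      rw [← mul_assoc, ← Real.exp_add, ← Real.exp_add]
      congr 2
      ring
    refine Asymptotics.IsBigO.trans_eventuallyEq ?_ (EventuallyEq.refl _ _)
    refine h4.trans_isBigO ?_
    have h5 : (fun s : ℝ => Real.exp (-(b/2) * (1 + s)) * (1 + s) ^ c) =O[atTop] fun _ => (1:ℝ) := by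
      have h6 := h3.mul (Asymptotics.isBigO_refl (fun s : ℝ => (1 + s) ^ c) atTop)
      refine h6.trans_eventuallyEq ?_
      filter_upwards [eventually_gt_atTop 0] with s hs
      simp only [Function.comp]
      rw [← Real.rpow_add (by linarith)]
      simp
    have h7 := (Asymptotics.isBigO_const_mul_self (Real.exp (b/2)) (fun s : ℝ => Real.exp (-(b/2) * s)) atTop).mul h5
    simpa using h7

/-- `1 - z^2` along `z = 1 + i s`. -/
noncomputable def bsq (s : ℝ) : ℂ := (s : ℂ) ^ 2 - 2 * Complex.I * s

noncomputable def bsg (a x s : ℝ) : ℂ :=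
  Complex.exp (Complex.I * x - x * s) * bsq s ^ (a : ℂ)

noncomputable def bsB (a x : ℝ) : ℂ := ∫ s in Ioi (0:ℝ), bsg a x s

noncomputable def bsz (s : ℝ) : ℂ := 1 + Complex.I * s

theorem bsq_eq (s : ℝ) : bsq s = 1 - bsz s ^ 2 := by
  simp only [bsq, bsz]
  ring_nf
  simp [Complex.I_sq]

theorem bsz_norm {s : ℝ} (hs : 0 ≤ s) : ‖bsz s‖ ≤ 1 + s := by
  unfold bsz
  refine (norm_add_le _ _).trans ?_
  simp [abs_of_nonneg hs]

theorem bsq_norm {s : ℝ} (hs : 0 ≤ s) : ‖bsq s‖ ≤ (1 + s) ^ (2:ℝ) := by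
  unfold bsq
  refine (norm_sub_le _ _).trans ?_
  simp [abs_of_nonneg hs]
  nlinarith

theorem bsg_norm {a x s : ℝ} (ha : 0 ≤ a) (hs : 0 ≤ s) :
    ‖bsg a x s‖ ≤ Real.exp (-x * s) * (1 + s) ^ (2 * a) := by
  unfold bsg
  rw [norm_mul, Complex.norm_cpow_real, Complex.norm_exp, Real.rpow_mul (by linarith)]
  have := bsq_norm hs
  have h2 : (Complex.I * x - x * s : ℂ).re = -x * s := by simp
  rw [h2]
  gcongr

theorem bsq_re {s : ℝ} : (bsq s).re = s ^ 2 := by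
  simp [bsq, pow_two]

theorem bsq_slit {s : ℝ} (hs : 0 < s) : bsq s ∈ Complex.slitPlane := by
  left
  rw [bsq_re]
  positivity

theorem bsq_cont : Continuous bsq := by unfold bsq; fun_prop
theorem bsz_cont : Continuous bsz := by unfold bsz; fun_prop

theorem bsqa_cont {a : ℝ} (ha : 0 < a) : Continuous fun s => bsq s ^ (a : ℂ) := by
  rw [continuous_iff_continuousAt]
  intro s
  have h := Complex.continuousAt_cpow_of_re_pos (p := (bsq s, (a:ℂ)))
    (Or.inl (by simp only [bsq_re]; positivity)) (by simpa using ha)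
  exact ContinuousAt.comp (f := fun s : ℝ => (bsq s, (a:ℂ))) h (by
    have := bsq_cont
    fun_prop)

theorem bsg_cont {a x : ℝ} (ha : 0 < a) : Continuous fun s => bsg a x s := by
  unfold bsg
  exact Continuous.mul (by fun_prop) (bsqa_cont ha)

theorem bszg_norm {a x s : ℝ} (ha : 0 ≤ a) (hs : 0 ≤ s) (k : ℕ) :
    ‖bsz s ^ k * bsg a x s‖ ≤ Real.exp (-x * s) * (1 + s) ^ (2 * a + k) := by
  rw [norm_mul, norm_pow]
  calc _ ≤ (1 + s) ^ k * (Real.exp (-x * s) * (1 + s) ^ (2 * a)) := by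
        gcongr
        · exact bsz_norm hs
        · exact bsg_norm ha hs
    _ = _ := by
      rw [Real.rpow_add (by linarith), Real.rpow_natCast]; ring

open MeasureTheory in
theorem bszg_int {a x : ℝ} (ha : 0 < a) (hx : 0 < x) (k : ℕ) :
    IntegrableOn (fun s => bsz s ^ k * bsg a x s) (Ioi 0) := by
  refine (bs_bound_integrable hx (2 * a + k)).mono' ?_ ?_
  · exact (Continuous.mul (bsz_cont.pow k) (bsg_cont ha)).aestronglyMeasurable
  · filter_upwards [ae_restrict_mem measurableSet_Ioi] with s hs
    exact bszg_norm ha.le (le_of_lt hs) k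

open MeasureTheory in
theorem bsg_int {a x : ℝ} (ha : 0 < a) (hx : 0 < x) :
    IntegrableOn (fun s => bsg a x s) (Ioi 0) := by
  simpa using bszg_int ha hx 0

theorem bs_tend {x : ℝ} (hx : 0 < x) (c : ℝ) :
    Tendsto (fun s : ℝ => Real.exp (-x * s) * (1 + s) ^ c) atTop (𝓝 0) := by
  have h1 := tendsto_rpow_mul_exp_neg_mul_atTop_nhds_zero c x hx
  have h2 : Tendsto (fun s : ℝ => 1 + s) atTop atTop := tendsto_atTop_add_const_left _ _ tendsto_id
  have h3 := ((h1.comp h2).mul_const (Real.exp x))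
  rw [zero_mul] at h3
  refine h3.congr ?_
  intro s
  simp only [Function.comp]
  rw [mul_assoc, ← Real.exp_add, mul_comm]
  congr 2
  ring

theorem bszg_tend {a x : ℝ} (ha : 0 < a) (hx : 0 < x) (k : ℕ) :
    Tendsto (fun s => bsz s ^ k * bsg a x s) atTop (𝓝 0) := by
  refine squeeze_zero_norm' ?_ (bs_tend hx (2 * a + k))
  filter_upwards [eventually_ge_atTop 0] with s hs
  exact bszg_norm ha.le hs k

theorem bsg_zero {a x : ℝ} (ha : 0 < a) : bsg a x 0 = 0 := by
  simp [bsg, bsq, ha.ne']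

theorem bsg_succ {a x s : ℝ} (hs : 0 < s) : bsg (a + 1) x s = bsq s * bsg a x s := by
  unfold bsg
  have : bsq s ≠ 0 := Complex.slitPlane_ne_zero (bsq_slit hs)
  push_cast
  rw [Complex.cpow_add _ _ this, Complex.cpow_one]
  ring

theorem bsz_deriv (s : ℝ) : HasDerivAt bsz Complex.I s := by
  unfold bsz
  have := ((Complex.ofRealCLM.hasDerivAt (x := s)).const_mul Complex.I).const_add (1:ℂ)
  simpa using this

theorem bsg_deriv {a x s : ℝ} (hs : 0 < s) :
    HasDerivAt (fun s => bsg (a + 1) x s)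
      (Complex.I * (Complex.I * x * bsg (a + 1) x s - 2 * (a + 1) * bsz s * bsg a x s)) s := by
  have hz := bsz_deriv s
  have hq : HasDerivAt bsq (-2 * Complex.I * bsz s) s := by
    have h := (hz.pow 2).const_sub 1
    have e : bsq = fun s => 1 - bsz s ^ 2 := funext bsq_eq
    rw [e]
    refine h.congr_deriv ?_
    simp
    ring
  have he : HasDerivAt (fun s : ℝ => Complex.exp (Complex.I * x - x * s))
      (Complex.exp (Complex.I * x - x * s) * (-x)) s := by
    have h0 : HasDerivAt (fun s : ℝ => (Complex.I * x - x * s : ℂ)) (-x) s := by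
      have := ((Complex.ofRealCLM.hasDerivAt (x := s)).const_mul (x:ℂ)).const_sub (Complex.I * x)
      simpa using this
    exact h0.cexp
  have hc := HasDerivAt.comp (h₂ := fun w : ℂ => w ^ ((a + 1 : ℝ) : ℂ)) s
    (hasDerivAt_id (bsq s) |>.cpow_const (c := ((a + 1 : ℝ) : ℂ)) (bsq_slit hs)) hq
  have := he.mul hc
  refine this.congr_deriv ?_
  have hne : bsq s ≠ 0 := Complex.slitPlane_ne_zero (bsq_slit hs)
  simp only [bsg, id]
  push_cast
  rw [add_sub_cancel_right]
  have hI : Complex.I * Complex.I = -1 := Complex.I_mul_I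
  simp only [Function.comp]
  linear_combination (-(x * Complex.exp (Complex.I * x - x * s) * bsq s ^ (a + 1 : ℂ))) * hI

open MeasureTheory in
theorem bs_ibp1 {a x : ℝ} (ha : 0 < a) (hx : 0 < x) :
    Complex.I * x * bsB (a + 1) x = 2 * (a + 1) * ∫ s in Ioi (0:ℝ), bsz s * bsg a x s := by
  have hi1 : IntegrableOn (fun s => bsg (a+1) x s) (Ioi 0) := bsg_int (by linarith) hx
  have hi2 : IntegrableOn (fun s => bsz s * bsg a x s) (Ioi 0) := by
    simpa using bszg_int ha hx 1
  have h := integral_Ioi_of_hasDerivAt_of_tendsto (a := 0) (m := 0) (f := fun s => bsg (a + 1) x s)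
    (bsg_cont (by linarith)).continuousWithinAt
    (fun s hs => bsg_deriv (a := a) (x := x) hs)
    (by
      have := ((hi1.const_mul (Complex.I * x)).sub (hi2.const_mul (2 * (a+1)))).const_mul Complex.I
      refine this.congr ?_
      filter_upwards with s
      simp
      ring)
    (by simpa using bszg_tend (a := a + 1) (by linarith) hx 0)
  rw [bsg_zero (by linarith), sub_zero, integral_const_mul] at h
  have h' := (mul_eq_zero.mp h).resolve_left Complex.I_ne_zero
  have h3 : ∀ s, Complex.I * x * bsg (a + 1) x s - 2 * (a + 1) * bsz s * bsg a x s =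
    Complex.I * x * bsg (a + 1) x s - 2 * (a + 1) * (bsz s * bsg a x s) := by intro s; ring
  simp_rw [h3] at h'
  rw [integral_sub (hi1.const_mul _) (hi2.const_mul _), integral_const_mul, integral_const_mul] at h'
  exact sub_eq_zero.mp h'

open MeasureTheory in
theorem bs_ibp2 {a x : ℝ} (ha : 0 < a) (hx : 0 < x) :
    Complex.I * x * (∫ s in Ioi (0:ℝ), bsz s * bsg (a + 1) x s) + (2 * a + 3) * bsB (a + 1) x
      = 2 * (a + 1) * bsB a x := by
  have hi0 : IntegrableOn (fun s => bsg a x s) (Ioi 0) := bsg_int ha hx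
  have hi1 : IntegrableOn (fun s => bsg (a+1) x s) (Ioi 0) := bsg_int (by linarith) hx
  have hi2 : IntegrableOn (fun s => bsz s * bsg (a+1) x s) (Ioi 0) := by
    simpa using bszg_int (a := a + 1) (by linarith) hx 1
  have hInteg := ((hi2.const_mul (Complex.I * x)).add ((hi1.const_mul ((2 * a + 3 : ℂ))))).sub
        (hi0.const_mul (2 * (a+1) : ℂ))
  have h := integral_Ioi_of_hasDerivAt_of_tendsto (a := 0) (m := 0)
    (f := fun s => bsz s * bsg (a + 1) x s)
    (f' := fun s => Complex.I * (Complex.I * x * (bsz s * bsg (a+1) x s) + (2 * a + 3) * bsg (a+1) x s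
      - 2 * (a + 1) * bsg a x s))
    (bsz_cont.mul (bsg_cont (by linarith))).continuousWithinAt
    (fun s hs => by
      have := (bsz_deriv s).mul (bsg_deriv (a := a) (x := x) hs)
      refine this.congr_deriv ?_
      have e := bsg_succ (a := a) (x := x) hs
      rw [bsq_eq] at e
      linear_combination (-(2 * a + 2) * Complex.I) * e)
    (hInteg.const_mul Complex.I)
    (by simpa using bszg_tend (a := a + 1) (by linarith) hx 1)
  rw [bsg_zero (by linarith), mul_zero, sub_zero, integral_const_mul] at h
  have h' := (mul_eq_zero.mp h).resolve_left Complex.I_ne_zero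
  have e1 := integral_sub ((hi2.const_mul (Complex.I * x)).add ((hi1.const_mul ((2 * a + 3 : ℂ)))))
    (hi0.const_mul (2 * (a+1) : ℂ))
  have e2 := integral_add (hi2.const_mul (Complex.I * x)) ((hi1.const_mul ((2 * a + 3 : ℂ))))
  simp only [Pi.add_apply] at e1
  rw [e2] at e1
  rw [e1, integral_const_mul, integral_const_mul, integral_const_mul] at h'
  exact sub_eq_zero.mp h'
open MeasureTheory in
theorem bsB_deriv {a x : ℝ} (ha : 0 < a) (hx : 0 < x) :
    HasDerivAt (fun x => bsB a x) (Complex.I * ∫ s in Ioi (0:ℝ), bsz s * bsg a x s) x := by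
  unfold bsB
  rw [← integral_const_mul]
  refine (hasDerivAt_integral_of_dominated_loc_of_deriv_le (s := Ioi (x/2))
    (bound := fun s => Real.exp (-(x/2) * s) * (1 + s) ^ (2 * a + 1))
    (F' := fun x s => Complex.I * (bsz s * bsg a x s))
    (Ioi_mem_nhds (by linarith)) ?_ (bsg_int ha hx) ?_ ?_ (bs_bound_integrable (by linarith) _) ?_).2
  · exact Eventually.of_forall fun x => (bsg_cont ha).aestronglyMeasurable
  · exact (continuous_const.mul (bsz_cont.mul (bsg_cont ha))).aestronglyMeasurable
  · filter_upwards [ae_restrict_mem measurableSet_Ioi] with s hs y hy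
    have hs' : 0 ≤ s := le_of_lt hs
    have hy' : x / 2 ≤ y := le_of_lt hy
    have h := bszg_norm (x := y) ha.le hs' 1
    rw [norm_mul, Complex.norm_I, one_mul]
    simp only [pow_one, Nat.cast_one] at h
    refine h.trans ?_
    have : 0 ≤ 1 + s := by linarith
    gcongr
  · filter_upwards with s y hy
    unfold bsg
    have h0 : HasDerivAt (fun y : ℝ => (Complex.I * y - y * s : ℂ)) (Complex.I - s) y := by
      have h1 := (Complex.ofRealCLM.hasDerivAt (x := y)).const_mul Complex.I
      have h2 := (Complex.ofRealCLM.hasDerivAt (x := y)).mul_const (s:ℂ)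
      have h3 := h1.sub h2
      simp only [Complex.ofRealCLM_apply, Complex.ofReal_one, mul_one, one_mul] at h3
      exact h3
    refine (h0.cexp.mul_const _).congr_deriv ?_
    have hI : Complex.I * Complex.I = -1 := Complex.I_mul_I
    unfold bsz
    linear_combination (-(s * Complex.exp (Complex.I * y - y * s) * bsq s ^ (a : ℂ))) * hI

open MeasureTheory in
theorem bsB_cont_nu {a x : ℝ} (ha : 0 < a) (hx : 0 < x) :
    ContinuousAt (fun a => bsB a x) a := by
  unfold bsB
  refine continuousAt_of_dominated (bound := fun s => Real.exp (-x * s) * (1 + s) ^ (2 * (a + 1)))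
    ?_ ?_ (bs_bound_integrable hx _) ?_
  · filter_upwards [Ioi_mem_nhds ha] with b hb
    exact (bsg_cont hb).aestronglyMeasurable
  · filter_upwards [Ioi_mem_nhds ha, Iio_mem_nhds (lt_add_one a)] with b hb hb2
    filter_upwards [ae_restrict_mem measurableSet_Ioi] with s hs
    have hs' : 0 < s := hs
    have hb3 : b < a + 1 := hb2
    refine (bsg_norm (le_of_lt hb) hs'.le).trans ?_
    gcongr
    linarith
  · filter_upwards [ae_restrict_mem measurableSet_Ioi] with s hs
    unfold bsg
    have h : bsq s ≠ 0 := Complex.slitPlane_ne_zero (bsq_slit hs)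
    refine ContinuousAt.mul continuousAt_const ?_
    exact ContinuousAt.const_cpow (by fun_prop) (Or.inl h)

theorem bs_real_mul_cpow {x : ℝ} (hx : 0 < x) (w c : ℂ) (hc : c ≠ 0) :
    (x * w : ℂ) ^ c = (x : ℂ) ^ c * w ^ c := by
  rcases eq_or_ne w 0 with rfl | hw
  · simp [hc]
  have hx' : (x : ℂ) ≠ 0 := by exact_mod_cast hx.ne'
  rw [Complex.cpow_def_of_ne_zero (mul_ne_zero hx' hw), Complex.log_ofReal_mul hx hw,
    Complex.cpow_def_of_ne_zero hx', Complex.cpow_def_of_ne_zero hw, ← Complex.exp_add,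
    Complex.ofReal_log hx.le]
  ring_nf

open MeasureTheory in
theorem bsB_asymp {a : ℝ} (ha : 0 < a) :
    Tendsto (fun x : ℝ => ((x ^ (a + 1) : ℝ) : ℂ) * Complex.exp (-(Complex.I * x)) * bsB a x) atTop
      (𝓝 ((-2 * Complex.I) ^ (a : ℂ) * (Real.Gamma (a + 1) : ℝ))) := by
  have hac : (a : ℂ) ≠ 0 := by exact_mod_cast ha.ne'
  have key : ∀ᶠ x : ℝ in atTop,
      ∫ t in Ioi (0:ℝ), (Real.exp (-t) : ℂ) * ((t:ℂ) ^ 2 * ((x⁻¹ : ℝ) : ℂ) - 2 * Complex.I * t) ^ (a : ℂ) =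
      ((x ^ (a + 1) : ℝ) : ℂ) * Complex.exp (-(Complex.I * x)) * bsB a x := by
    filter_upwards [eventually_gt_atTop 0] with x hx
    unfold bsB
    have h := integral_comp_mul_left_Ioi' (fun s => bsg a x s) 0 (inv_pos.mpr hx)
    rw [mul_zero] at h
    rw [← h, Complex.real_smul, ← mul_assoc, ← integral_const_mul]
    refine setIntegral_congr_fun measurableSet_Ioi fun t ht => ?_
    have hx' : (x : ℂ) ≠ 0 := by exact_mod_cast hx.ne'
    have e1 : ((t:ℂ) ^ 2 * ((x⁻¹ : ℝ) : ℂ) - 2 * Complex.I * t) = x * bsq (x⁻¹ * t) := by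
      unfold bsq
      push_cast
      field_simp
    rw [e1, bs_real_mul_cpow hx _ _ hac]
    unfold bsg
    rw [Real.rpow_add hx, Real.rpow_one]
    have e2 : Complex.exp (Complex.I * x - x * ((x⁻¹ * t : ℝ) : ℂ)) =
        Complex.exp (Complex.I * x) * (Real.exp (-t) : ℂ) := by
      rw [Complex.ofReal_exp, ← Complex.exp_add]
      congr 1
      push_cast
      field_simp
      ring
    rw [e2, Complex.exp_neg, Complex.ofReal_mul, Complex.ofReal_cpow hx.le]
    have := Complex.exp_ne_zero (Complex.I * x)
    push_cast
    field_simp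
  have lim : ∫ t in Ioi (0:ℝ), (Real.exp (-t) : ℂ) * (- 2 * Complex.I * t) ^ (a : ℂ) =
      ((-2 * Complex.I) ^ (a : ℂ) * (Real.Gamma (a + 1) : ℝ)) := by
    rw [Real.Gamma_eq_integral (by linarith), ← integral_complex_ofReal, ← integral_const_mul]
    refine setIntegral_congr_fun measurableSet_Ioi fun t ht => ?_
    have ht' : 0 < t := ht
    rw [mul_comm (-2 * Complex.I) (t:ℂ), bs_real_mul_cpow ht' _ _ hac, add_sub_cancel_right]
    push_cast
    rw [Complex.ofReal_cpow ht'.le]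
    ring
  rw [← lim]
  refine Tendsto.congr' key ?_
  refine tendsto_integral_filter_of_dominated_convergence
    (fun t => Real.exp (-1 * t) * (1 + t) ^ (2 * a)) ?_ ?_ (bs_bound_integrable one_pos _) ?_
  · filter_upwards [eventually_gt_atTop 0] with x hx
    refine Continuous.aestronglyMeasurable ?_
    refine Continuous.mul (by fun_prop) ?_
    rw [continuous_iff_continuousAt]
    intro t
    have hre : 0 ≤ ((t:ℂ) ^ 2 * ((x⁻¹ : ℝ) : ℂ) - 2 * Complex.I * t).re := by
      have : ((t:ℂ) ^ 2 * ((x⁻¹ : ℝ) : ℂ) - 2 * Complex.I * t).re = t ^ 2 * x⁻¹ := by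
        rw [← Complex.ofReal_pow, ← Complex.ofReal_mul, Complex.sub_re, Complex.ofReal_re]
        simp
      rw [this]; positivity
    have h := Complex.continuousAt_cpow_of_re_pos
      (p := (((t:ℂ) ^ 2 * ((x⁻¹ : ℝ) : ℂ) - 2 * Complex.I * t), (a:ℂ)))
      (Or.inl hre) (by simpa using ha)
    exact ContinuousAt.comp
      (f := fun t : ℝ => (((t:ℂ) ^ 2 * ((x⁻¹ : ℝ) : ℂ) - 2 * Complex.I * t), (a:ℂ))) h (by fun_prop)
  · filter_upwards [eventually_ge_atTop 1] with x hx
    filter_upwards [ae_restrict_mem measurableSet_Ioi] with t ht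
    have ht' : 0 < t := ht
    rw [norm_mul, Complex.norm_cpow_real, Complex.norm_real, Real.norm_eq_abs, Real.abs_exp,
      Real.rpow_mul (by linarith), neg_one_mul]
    have hxi : x⁻¹ ≤ 1 := inv_le_one_of_one_le₀ hx
    have hxi0 : 0 ≤ x⁻¹ := by positivity
    gcongr
    refine (norm_sub_le _ _).trans ?_
    simp only [norm_mul, norm_pow, Complex.norm_real, Real.norm_eq_abs, abs_of_pos ht', Complex.norm_I,
      Complex.norm_ofNat, abs_of_nonneg hxi0, Real.rpow_two]
    nlinarith
  · filter_upwards [ae_restrict_mem measurableSet_Ioi] with t ht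
    have ht' : 0 < t := ht
    refine Tendsto.const_mul _ ?_
    have h1 : Tendsto (fun x : ℝ => ((t:ℂ) ^ 2 * ((x⁻¹ : ℝ) : ℂ) - 2 * Complex.I * t)) atTop
        (𝓝 (-2 * Complex.I * t)) := by
      have h2 : Tendsto (fun x : ℝ => ((x⁻¹ : ℝ) : ℂ)) atTop (𝓝 ((0:ℝ):ℂ)) :=
        (Complex.continuous_ofReal.tendsto 0).comp tendsto_inv_atTop_zero
      have h3 := (h2.const_mul ((t:ℂ)^2)).sub_const (2 * Complex.I * t)
      simpa using h3
    refine h1.cpow tendsto_const_nhds ?_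
    right
    simpa using ht'.ne'

noncomputable def bsC (ν : ℝ) : ℝ := ((2:ℝ) ^ ν * √π * Real.Gamma (ν + 1 / 2))⁻¹

/-- Half of the Hankel function. -/
noncomputable def bsK (ν x : ℝ) : ℂ := -Complex.I * ((bsC ν * x ^ ν : ℝ) : ℂ) * bsB (ν - 1 / 2) x

theorem bsC_succ {ν : ℝ} (hν : 1 / 2 < ν) : (2 * ν + 1) * bsC (ν + 1) = bsC ν := by
  unfold bsC
  rw [show ν + 1 + 1 / 2 = (ν + 1 / 2) + 1 by ring, Real.Gamma_add_one (by linarith),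
    Real.rpow_add (by norm_num), Real.rpow_one]
  have h1 : Real.Gamma (ν + 1 / 2) ≠ 0 := (Real.Gamma_pos_of_pos (by linarith)).ne'
  have h2 : √π ≠ 0 := by positivity
  have h3 : (2:ℝ) ^ ν ≠ 0 := by positivity
  have h4 : ν + 1 / 2 ≠ 0 := by linarith
  field_simp

theorem bsK_deriv_aux {ν x : ℝ} (hν : 1 / 2 < ν) (hx : 0 < x) :
    HasDerivAt (fun x => bsK ν x) (((ν / x : ℝ) : ℂ) * bsK ν x +
      (-Complex.I * ((bsC ν * x ^ ν : ℝ) : ℂ) *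
        (Complex.I * ∫ s in Ioi (0:ℝ), bsz s * bsg (ν - 1 / 2) x s))) x := by
  have hB := bsB_deriv (a := ν - 1/2) (by linarith) hx
  have hp : HasDerivAt (fun x : ℝ => ((bsC ν * x ^ ν : ℝ) : ℂ)) ((bsC ν * (ν * x ^ (ν - 1)) : ℝ) : ℂ) x :=
    ((Real.hasDerivAt_rpow_const (Or.inl hx.ne')).const_mul _).ofReal_comp
  have := (hp.const_mul (-Complex.I)).mul hB
  unfold bsK
  refine this.congr_deriv ?_
  rw [Real.rpow_sub hx, Real.rpow_one]
  have hx' : (x : ℂ) ≠ 0 := by exact_mod_cast hx.ne'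
  push_cast
  field_simp

theorem bsK_deriv {ν x : ℝ} (hν : 1 / 2 < ν) (hx : 0 < x) :
    HasDerivAt (fun x => bsK ν x) (((ν / x : ℝ) : ℂ) * bsK ν x - bsK (ν + 1) x) x := by
  refine (bsK_deriv_aux hν hx).congr_deriv ?_
  have h := bs_ibp1 (a := ν - 1/2) (by linarith) hx
  rw [sub_eq_add_neg (((ν / x : ℝ) : ℂ) * bsK ν x)]
  congr 1
  rw [bsK, show ν + 1 - 1/2 = ν - 1/2 + 1 by ring, ← bsC_succ hν, Real.rpow_add hx, Real.rpow_one]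
  push_cast at h ⊢
  linear_combination (-(bsC (ν + 1)) * ((x ^ ν : ℝ) : ℂ)) * h -
    (bsC (ν + 1)) * ((x ^ ν : ℝ) : ℂ) * (2 * ν + 1) * (∫ s in Ioi (0:ℝ), bsz s * bsg (ν - 1 / 2) x s)
      * Complex.I_mul_I

theorem bsK_rec {ν x : ℝ} (hν : 1 / 2 < ν) (hx : 0 < x) :
    HasDerivAt (fun x => bsK (ν + 1) x) (bsK ν x - (((ν + 1) / x : ℝ) : ℂ) * bsK (ν + 1) x) x := by
  refine (bsK_deriv_aux (by linarith) hx).congr_deriv ?_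
  have h := bs_ibp2 (a := ν - 1/2) (by linarith) hx
  rw [bsK, bsK, show ν + 1 - 1/2 = ν - 1/2 + 1 by ring, ← bsC_succ hν, Real.rpow_add hx, Real.rpow_one]
  have hx' : (x : ℂ) ≠ 0 := by exact_mod_cast hx.ne'
  push_cast at h ⊢
  have hd : ((ν + 1) / x : ℂ) * x = ν + 1 := by field_simp
  linear_combination (-(bsC (ν + 1)) * ((x ^ ν : ℝ) : ℂ)) * (Complex.I * h) +
    (-2 * Complex.I * (bsC (ν + 1)) * ((x ^ ν : ℝ) : ℂ) * bsB (ν - 1 / 2 + 1) x) * hd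

theorem bsK_cont_nu {ν x : ℝ} (hν : 1 / 2 < ν) (hx : 0 < x) :
    ContinuousAt (fun ν => bsK ν x) ν := by
  unfold bsK
  have hB : ContinuousAt (fun ν => bsB (ν - 1 / 2) x) ν :=
    ContinuousAt.comp (f := fun ν => ν - 1/2) (g := fun a => bsB a x)
      (bsB_cont_nu (by linarith) hx) (by fun_prop)
  have hC : ContinuousAt (fun ν => bsC ν * x ^ ν) ν := by
    unfold bsC
    have hG : ContinuousAt (fun ν => Real.Gamma (ν + 1/2)) ν :=
      ContinuousAt.comp (f := fun ν : ℝ => ν + 1/2) (g := Real.Gamma)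
        (Real.differentiableAt_Gamma (by
          intro m hm
          have : (0:ℝ) ≤ m := by positivity
          linarith)).continuousAt (by fun_prop)
    refine ContinuousAt.mul (ContinuousAt.inv₀ (ContinuousAt.mul (ContinuousAt.mul ?_ continuousAt_const) hG) ?_) ?_
    · exact (Real.continuous_const_rpow (by norm_num)).continuousAt
    · have h1 : Real.Gamma (ν + 1 / 2) ≠ 0 := (Real.Gamma_pos_of_pos (by linarith)).ne'
      positivity
    · exact (Real.continuous_const_rpow hx.ne').continuousAt
  refine ContinuousAt.mul (ContinuousAt.mul continuousAt_const ?_) hB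
  exact Complex.continuous_ofReal.continuousAt.comp hC

theorem bsK_asymp {ν : ℝ} (hν : 1 / 2 < ν) :
    Tendsto (fun x : ℝ => (√x : ℂ) * Complex.exp (-(Complex.I * x)) * bsK ν x) atTop
      (𝓝 (((√(2 / π) / 2 : ℝ) : ℂ) * Complex.exp (-(((ν + 1 / 2) * π / 2 : ℝ) : ℂ) * Complex.I))) := by
  have h := (bsB_asymp (a := ν - 1/2) (by linarith)).const_mul (-Complex.I * bsC ν)
  have e : -Complex.I * bsC ν * ((-2 * Complex.I) ^ ((ν - 1/2 : ℝ) : ℂ) * (Real.Gamma (ν - 1/2 + 1) : ℝ)) =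
     (((√(2 / π) / 2 : ℝ) : ℂ) * Complex.exp (-(((ν + 1 / 2) * π / 2 : ℝ) : ℂ) * Complex.I)) := by
    have hn : ((ν - 1/2 : ℝ) : ℂ) ≠ 0 := by
      have : ν - 1/2 ≠ 0 := by linarith
      exact_mod_cast this
    have e1 : (-2 * Complex.I : ℂ) = ((2:ℝ):ℂ) * (-Complex.I) := by push_cast; ring
    have e2 : (-Complex.I) ^ ((ν - 1/2 : ℝ) : ℂ) = Complex.exp (-(((ν - 1 / 2) * π / 2 : ℝ) : ℂ) * Complex.I) := by
      rw [Complex.cpow_def_of_ne_zero (by simp), Complex.log_neg_I]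
      congr 1
      push_cast
      ring
    have e3 : -Complex.I = Complex.exp (-((π / 2 : ℝ) : ℂ) * Complex.I) := by
      rw [← Complex.exp_log (x := -Complex.I) (by simp), Complex.log_neg_I]
      push_cast
      ring_nf
    rw [e1, bs_real_mul_cpow two_pos _ _ hn, e2, e3,
      show (-(((ν + 1 / 2) * π / 2 : ℝ) : ℂ) * Complex.I) = (-((π / 2 : ℝ) : ℂ) * Complex.I) +
        (-(((ν - 1 / 2) * π / 2 : ℝ) : ℂ) * Complex.I) by push_cast; ring, Complex.exp_add]
    have e4 : bsC ν * ((2:ℝ) ^ (ν - 1/2) * Real.Gamma (ν - 1/2 + 1)) = √(2/π) / 2 := by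
      unfold bsC
      rw [show ν - 1/2 + 1 = ν + 1/2 by ring, Real.rpow_sub two_pos, ← Real.sqrt_eq_rpow,
        Real.sqrt_div two_pos.le]
      have h1 : Real.Gamma (ν + 1 / 2) ≠ 0 := (Real.Gamma_pos_of_pos (by linarith)).ne'
      have h2 : √π ≠ 0 := by positivity
      have h3 : (2:ℝ) ^ ν ≠ 0 := by positivity
      field_simp
      norm_num
    rw [← e4]
    rw [← Complex.ofReal_cpow two_pos.le]
    push_cast
    ring
  rw [e] at h
  refine h.congr' ?_
  filter_upwards [eventually_gt_atTop 0] with x hx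
  unfold bsK
  rw [show ν - 1/2 + 1 = 1/2 + ν by ring, Real.rpow_add hx, ← Real.sqrt_eq_rpow]
  push_cast
  ring
theorem bsp_cont {a : ℝ} (ha : 0 < a) : Continuous fun t : ℝ => (1 - t ^ 2) ^ a :=
  Continuous.rpow_const (by fun_prop) fun _ => Or.inr ha.le

theorem bsI_zero {a : ℝ} (ha : 0 < a) :
    ∫ t in (-1:ℝ)..1, (1 - t ^ 2) ^ a = √π * Real.Gamma (a + 1) / Real.Gamma (a + 3 / 2) := by
  have h1 := intervalIntegral.integral_comp_mul_sub (a := 0) (b := 1)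
    (fun t : ℝ => (1 - t ^ 2) ^ a) (c := 2) two_ne_zero 1
  norm_num at h1
  have h2 : ∫ x in (0:ℝ)..1, (1 - (2 * x - 1) ^ 2) ^ a =
      (4:ℝ) ^ a * ∫ x in (0:ℝ)..1, x ^ a * (1 - x) ^ a := by
    rw [← intervalIntegral.integral_const_mul]
    refine intervalIntegral.integral_congr fun x hx => ?_
    rw [uIcc_of_le zero_le_one] at hx
    rw [← Real.mul_rpow hx.1 (by linarith [hx.2]), ← Real.mul_rpow (by norm_num)
      (mul_nonneg hx.1 (by linarith [hx.2]))]
    congr 1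
    ring
  have h3 : ∫ x in (0:ℝ)..1, x ^ a * (1 - x) ^ a =
      Real.Gamma (a + 1) * Real.Gamma (a + 1) / Real.Gamma (a + 1 + (a + 1)) := by
    have h4 := Complex.Gamma_mul_Gamma_eq_betaIntegral (s := ((a + 1 : ℝ) : ℂ)) (t := ((a + 1 : ℝ) : ℂ))
      (by simp; linarith) (by simp; linarith)
    have h5 : Complex.betaIntegral ((a + 1 : ℝ) : ℂ) ((a + 1 : ℝ) : ℂ) =
        ((∫ x in (0:ℝ)..1, x ^ a * (1 - x) ^ a : ℝ) : ℂ) := by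
      unfold Complex.betaIntegral
      rw [← intervalIntegral.integral_ofReal]
      refine intervalIntegral.integral_congr fun x hx => ?_
      rw [uIcc_of_le zero_le_one] at hx
      push_cast
      rw [add_sub_cancel_right, Complex.ofReal_cpow hx.1, Complex.ofReal_cpow (by linarith [hx.2])]
      push_cast
      rfl
    rw [h5, ← Complex.ofReal_add, Complex.Gamma_ofReal, Complex.Gamma_ofReal] at h4
    have h6 : Real.Gamma (a + 1 + (a + 1)) ≠ 0 := (Real.Gamma_pos_of_pos (by linarith)).ne'
    rw [eq_div_iff h6, mul_comm]
    exact_mod_cast h4.symm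
  have h7 := Real.Gamma_mul_Gamma_add_half (a + 1)
  rw [h2, h3] at h1
  have h8 : Real.Gamma (a + 1 + (a + 1)) ≠ 0 := (Real.Gamma_pos_of_pos (by linarith)).ne'
  have h9 : Real.Gamma (a + 3 / 2) ≠ 0 := (Real.Gamma_pos_of_pos (by linarith)).ne'
  rw [show a + 1 + 1 / 2 = a + 3 / 2 by ring, show 2 * (a + 1) = a + 1 + (a + 1) by ring] at h7
  rw [eq_div_iff h9]
  have h10 : (4:ℝ) ^ a * (2:ℝ) ^ (1 - (a + 1 + (a + 1))) = 1 / 2 := by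
    rw [show (4:ℝ) = 2 ^ (2:ℝ) by norm_num, ← Real.rpow_mul two_pos.le, ← Real.rpow_add two_pos]
    rw [show 2 * a + (1 - (a + 1 + (a + 1))) = -1 by ring, Real.rpow_neg_one]
    norm_num
  have h11 : ∫ t in (-1:ℝ)..1, (1 - t ^ 2) ^ a =
    2 * (4 ^ a * (Real.Gamma (a + 1) * Real.Gamma (a + 1) / Real.Gamma (a + 1 + (a + 1)))) := by
    linarith
  rw [h11]
  calc _ = 2 * 4 ^ a * Real.Gamma (a + 1) / Real.Gamma (a + 1 + (a + 1)) *
        (Real.Gamma (a + 1) * Real.Gamma (a + 3/2)) := by ring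
    _ = 2 * (4 ^ a * (2:ℝ) ^ (1 - (a + 1 + (a + 1)))) * Real.Gamma (a + 1) * √π *
        (Real.Gamma (a + 1 + (a + 1)) / Real.Gamma (a + 1 + (a + 1))) := by rw [h7]; ring
    _ = _ := by rw [h10, div_self h8]; ring

theorem bsI_succ {a : ℝ} (ha : 0 < a) (m : ℕ) :
    (2 * m + 2 * a + 3) * (∫ t in (-1:ℝ)..1, t ^ (2 * (m + 1)) * (1 - t ^ 2) ^ a) =
      (2 * m + 1) * ∫ t in (-1:ℝ)..1, t ^ (2 * m) * (1 - t ^ 2) ^ a := by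
  have hc := bsp_cont ha
  have h := intervalIntegral.integral_eq_sub_of_hasDerivAt (a := -1) (b := 1)
    (f := fun t : ℝ => t ^ (2 * m + 1) * (1 - t ^ 2) ^ (a + 1))
    (f' := fun t => (2 * m + 1) * (t ^ (2 * m) * (1 - t ^ 2) ^ (a + 1)) -
      (2 * a + 2) * (t ^ (2 * (m + 1)) * (1 - t ^ 2) ^ a))
    (fun t _ => by
      have h1 := (hasDerivAt_pow (2 * m + 1) t)
      have h2 : HasDerivAt (fun t : ℝ => 1 - t ^ 2) (-(2 * t)) t := by
        simpa using (hasDerivAt_pow 2 t).const_sub 1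
      have h3 := h2.rpow_const (p := a + 1) (Or.inr (by linarith))
      refine (h1.mul h3).congr_deriv ?_
      push_cast
      rw [add_sub_cancel_right]
      ring)
    (by
      have := bsp_cont (a := a + 1) (by linarith)
      apply Continuous.intervalIntegrable
      fun_prop)
  have h0 : ∀ t ∈ uIcc (-1:ℝ) 1, (2 * m + 1) * (t ^ (2 * m) * (1 - t ^ 2) ^ (a + 1)) -
      (2 * a + 2) * (t ^ (2 * (m + 1)) * (1 - t ^ 2) ^ a) =
      (2 * m + 1) * (t ^ (2 * m) * (1 - t ^ 2) ^ a) - (2 * m + 2 * a + 3) *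
      (t ^ (2 * (m + 1)) * (1 - t ^ 2) ^ a) := by
    intro t ht
    rw [uIcc_of_le (by norm_num)] at ht
    have : 0 ≤ 1 - t ^ 2 := by nlinarith [ht.1, ht.2]
    rw [Real.rpow_add_one' this (by linarith)]
    ring
  rw [intervalIntegral.integral_congr h0, intervalIntegral.integral_sub,
    intervalIntegral.integral_const_mul, intervalIntegral.integral_const_mul] at h
  · norm_num [Real.zero_rpow (show a + 1 ≠ 0 by linarith)] at h
    linarith
  · apply Continuous.intervalIntegrable
    fun_prop
  · apply Continuous.intervalIntegrable
    fun_prop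

theorem bsI_eq {a : ℝ} (ha : 0 < a) (m : ℕ) :
    ∫ t in (-1:ℝ)..1, t ^ (2 * m) * (1 - t ^ 2) ^ a =
      √π * (2 * m).factorial / (4 ^ m * m.factorial) * Real.Gamma (a + 1) /
        Real.Gamma (m + (a + 3 / 2)) := by
  induction m with
  | zero => simpa using bsI_zero ha
  | succ m ih =>
    have h := bsI_succ ha m
    rw [ih] at h
    have h1 : (2 * m + 2 * a + 3) ≠ 0 := by positivity
    rw [← mul_right_inj' h1, h]
    have h2 : Real.Gamma (m + (a + 3 / 2)) ≠ 0 := (Real.Gamma_pos_of_pos (by positivity)).ne'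
    have h3 : (m:ℝ) + (a + 3 / 2) ≠ 0 := by positivity
    rw [show ((m + 1 : ℕ) : ℝ) + (a + 3 / 2) = (m + (a + 3/2)) + 1 by push_cast; ring,
      Real.Gamma_add_one h3, show 2 * (m + 1) = 2 * m + 1 + 1 by ring,
      Nat.factorial_succ, Nat.factorial_succ, Nat.factorial_succ]
    push_cast
    field_simp
    ring

theorem bs_poisson {ν x : ℝ} (hν : 1 / 2 < ν) (hx : 0 < x) :
    HasSum (fun m : ℕ => ((-1 : ℝ) ^ m / (m.factorial * Real.Gamma ((m : ℝ) + ν + 1))) *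
      (x / 2) ^ (2 * (m : ℝ) + ν))
      (bsC ν * x ^ ν * ∫ t in (-1:ℝ)..1, Real.cos (x * t) * (1 - t ^ 2) ^ (ν - 1 / 2)) := by
  have ha : 0 < ν - 1/2 := by linarith
  have hc := bsp_cont ha
  have hs : Summable fun m : ℕ => x ^ (2 * m) / ((2 * m).factorial : ℝ) := by
    have := (Real.summable_pow_div_factorial x).comp_injective (i := fun m : ℕ => 2 * m)
      (fun m n h => by simpa using h)
    exact this
  have h := intervalIntegral.hasSum_integral_of_dominated_convergence (a := -1) (b := 1)
    (μ := MeasureTheory.volume)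
    (F := fun (m : ℕ) t => ((-1) ^ m * (x * t) ^ (2 * m) / ((2 * m).factorial : ℝ)) * (1 - t ^ 2) ^ (ν - 1 / 2))
    (f := fun t => Real.cos (x * t) * (1 - t ^ 2) ^ (ν - 1 / 2))
    (fun m _ => x ^ (2 * m) / ((2 * m).factorial : ℝ))
    (fun m => by
      apply Continuous.aestronglyMeasurable
      fun_prop)
    (fun m => by
      filter_upwards with t ht
      rw [uIoc_of_le (by norm_num)] at ht
      have h1 : 0 ≤ 1 - t ^ 2 := by nlinarith [ht.1, ht.2]
      have h2 : (1 - t ^ 2) ^ (ν - 1/2) ≤ 1 := Real.rpow_le_one h1 (by nlinarith) ha.le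
      have h3 : 0 ≤ (1 - t ^ 2) ^ (ν - 1/2) := Real.rpow_nonneg h1 _
      have h4 : |t| ≤ 1 := abs_le.mpr ⟨ht.1.le, ht.2⟩
      rw [Real.norm_eq_abs, abs_mul, abs_div, abs_mul, abs_pow, abs_neg, abs_one, one_pow, one_mul,
        abs_pow, abs_mul, abs_of_pos hx, abs_of_nonneg h3, Nat.abs_cast, mul_pow]
      have h5 : |t| ^ (2 * m) ≤ 1 := pow_le_one₀ (abs_nonneg t) h4
      calc _ ≤ x ^ (2 * m) * 1 / ((2 * m).factorial : ℝ) * 1 := by gcongr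
        _ = _ := by ring)
    (by filter_upwards with t ht using hs)
    (by simp)
    (by
      filter_upwards with t ht
      exact (Real.hasSum_cos (x * t)).mul_right _)
  have h' := h.mul_left (bsC ν * x ^ ν)
  refine h'.congr_fun ?_
  intro m
  have e : ∀ t : ℝ, ((-1) ^ m * (x * t) ^ (2 * m) / ((2 * m).factorial : ℝ)) * (1 - t ^ 2) ^ (ν - 1 / 2) =
    ((-1) ^ m * x ^ (2 * m) / ((2 * m).factorial : ℝ)) * (t ^ (2 * m) * (1 - t ^ 2) ^ (ν - 1 / 2)) := by
    intro t; rw [mul_pow]; ring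
  simp_rw [e]
  rw [intervalIntegral.integral_const_mul, bsI_eq ha m]
  rw [show ν - 1 / 2 + 1 = ν + 1 / 2 by ring,
    show (m:ℝ) + (ν - 1/2 + 3/2) = m + ν + 1 by ring]
  unfold bsC
  rw [Real.div_rpow hx.le two_pos.le, Real.rpow_add hx, Real.rpow_add two_pos]
  have e2 : ∀ y : ℝ, y ^ (2 * (m:ℝ)) = y ^ (2 * m) := by
    intro y; rw [← Real.rpow_natCast]; push_cast; rfl
  rw [e2, e2, pow_mul (2:ℝ)]
  have h1 : Real.Gamma (ν + 1 / 2) ≠ 0 := (Real.Gamma_pos_of_pos (by linarith)).ne'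
  have h4 : Real.Gamma (m + ν + 1) ≠ 0 := (Real.Gamma_pos_of_pos (by positivity)).ne'
  have h2 : √π ≠ 0 := by positivity
  have h3 : (2:ℝ) ^ ν ≠ 0 := by positivity
  norm_num
  field_simp
noncomputable def bsf (a x : ℝ) (z : ℂ) : ℂ := Complex.exp (Complex.I * x * z) * (1 - z ^ 2) ^ (a : ℂ)

theorem bs_re_one_sub (z : ℂ) : (1 - z ^ 2).re = 1 - z.re ^ 2 + z.im ^ 2 := by
  simp [pow_two]; ring

theorem bsf_right {a x y : ℝ} : bsf a x (1 + y * Complex.I) = bsg a x y := by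
  unfold bsf bsg
  congr 1
  · congr 1
    linear_combination (x * y) * Complex.I_mul_I
  · rw [bsq_eq]; unfold bsz; congr 2; ring

theorem bsf_left {a x y : ℝ} : bsf a x (-1 + y * Complex.I) =
    (starRingEnd ℂ) (bsg a x y) := by
  unfold bsf bsg
  rw [map_mul, ← Complex.exp_conj]
  congr 1
  · congr 1
    simp
    linear_combination (x * y) * Complex.I_mul_I
  · have h : (bsq y).arg ≠ π := by
      intro h
      have := Complex.arg_eq_pi_iff.mp h
      rw [bsq_re] at this
      nlinarith [this.1, sq_nonneg y]
    have h2 := Complex.conj_cpow (bsq y) (a : ℂ) h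
    rw [Complex.conj_ofReal] at h2
    rw [← h2]
    congr 1
    unfold bsq
    simp
    have h3 : (starRingEnd ℂ) 2 = 2 := map_ofNat _ 2
    rw [h3]
    linear_combination (-(y:ℂ)^2) * Complex.I_mul_I

theorem bsf_contOn {a x : ℝ} (ha : 0 < a) (z : ℂ) (h : 0 ≤ (1 - z ^ 2).re) :
    ContinuousAt (bsf a x) z := by
  unfold bsf
  refine ContinuousAt.mul (by fun_prop) ?_
  have h := Complex.continuousAt_cpow_of_re_pos (p := (1 - z ^ 2, (a:ℂ))) (Or.inl h) (by simpa using ha)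
  exact ContinuousAt.comp (f := fun z : ℂ => (1 - z ^ 2, (a:ℂ))) h (by fun_prop)

theorem bs_rect {a x : ℝ} (ha : 0 < a) (R : ℝ) (hR : 0 ≤ R) :
    (∫ t in (-1:ℝ)..1, bsf a x t) = (∫ t in (-1:ℝ)..1, bsf a x (t + R * Complex.I)) -
      Complex.I * (∫ y in (0:ℝ)..R, bsg a x y) +
      Complex.I * (starRingEnd ℂ) (∫ y in (0:ℝ)..R, bsg a x y) := by
  have h := Complex.integral_boundary_rect_eq_zero_of_continuousOn_of_differentiableOn (bsf a x)
    (⟨-1, 0⟩ : ℂ) (⟨1, R⟩ : ℂ) (by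
      intro z hz
      refine (bsf_contOn ha z ?_).continuousWithinAt
      have h1 := (Complex.mem_reProdIm.mp hz).1
      simp only at h1
      rw [uIcc_of_le (by norm_num)] at h1
      rw [bs_re_one_sub]
      nlinarith [h1.1, h1.2, sq_nonneg z.im])
    (by
      intro z hz
      refine DifferentiableAt.differentiableWithinAt ?_
      have h1 := (Complex.mem_reProdIm.mp hz).1
      norm_num at h1
      unfold bsf
      refine DifferentiableAt.mul (by fun_prop) ?_
      refine DifferentiableAt.cpow (by fun_prop) (by fun_prop) ?_
      left
      rw [bs_re_one_sub]
      nlinarith [h1.1, h1.2, sq_nonneg z.im])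
  have e1 : ∀ y : ℝ, bsf a x (((-1 : ℝ) : ℂ) + y * Complex.I) = (starRingEnd ℂ) (bsg a x y) := by
    intro y; rw [← bsf_left]; push_cast; rfl
  have e2 : ∀ y : ℝ, bsf a x (((1 : ℝ) : ℂ) + y * Complex.I) = bsg a x y := by
    intro y; rw [← bsf_right]; push_cast; rfl
  simp only [e1, e2, Complex.ofReal_zero, zero_mul, add_zero, smul_eq_mul] at h
  have e3 : ∫ y in (0:ℝ)..R, (starRingEnd ℂ) (bsg a x y) = (starRingEnd ℂ) (∫ y in (0:ℝ)..R, bsg a x y) := by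
    rw [intervalIntegral.integral_of_le hR, intervalIntegral.integral_of_le hR, integral_conj]
  rw [e3] at h
  linear_combination h

theorem bs_top {a x : ℝ} (ha : 0 < a) (hx : 0 < x) :
    Tendsto (fun R : ℝ => ∫ t in (-1:ℝ)..1, bsf a x (t + R * Complex.I)) atTop (𝓝 0) := by
  have h := (bs_tend hx (2 * a)).const_mul ((2:ℝ) ^ a * 2)
  rw [mul_zero] at h
  refine squeeze_zero_norm' ?_ h
  filter_upwards [eventually_ge_atTop 0] with R hR
  have h2 := intervalIntegral.norm_integral_le_of_norm_le_const (a := -1) (b := 1)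
    (f := fun t : ℝ => bsf a x (t + R * Complex.I)) (C := (2:ℝ) ^ a * (Real.exp (-x * R) * (1 + R) ^ (2 * a))) (by
      intro t ht
      rw [uIoc_of_le (by norm_num)] at ht
      unfold bsf
      rw [norm_mul, Complex.norm_cpow_real, Complex.norm_exp]
      have e : (Complex.I * x * (t + R * Complex.I)).re = -x * R := by simp
      rw [e, Real.rpow_mul (by linarith), mul_left_comm, ← Real.mul_rpow (by norm_num) (by positivity)]
      gcongr
      refine (norm_sub_le _ _).trans ?_
      rw [norm_pow, norm_one]
      have h3 : ‖(t + R * Complex.I : ℂ)‖ ≤ 1 + R := by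
        refine (norm_add_le _ _).trans ?_
        simp only [norm_mul, Complex.norm_real, Complex.norm_I, Real.norm_eq_abs, abs_of_nonneg hR, mul_one]
        gcongr
        exact abs_le.mpr ⟨ht.1.le, ht.2⟩
      have h4 := pow_le_pow_left₀ (norm_nonneg _) h3 2
      rw [Real.rpow_two]
      nlinarith)
  refine h2.trans (le_of_eq ?_)
  norm_num
  ring

theorem bs_contour {a x : ℝ} (ha : 0 < a) (hx : 0 < x) :
    (∫ t in (-1:ℝ)..1, bsf a x t) = -Complex.I * bsB a x + (starRingEnd ℂ) (-Complex.I * bsB a x) := by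
  have hB : Tendsto (fun R : ℝ => ∫ y in (0:ℝ)..R, bsg a x y) atTop (𝓝 (bsB a x)) :=
    MeasureTheory.intervalIntegral_tendsto_integral_Ioi 0 (bsg_int ha hx) tendsto_id
  have hBc : Tendsto (fun R : ℝ => (starRingEnd ℂ) (∫ y in (0:ℝ)..R, bsg a x y)) atTop
      (𝓝 ((starRingEnd ℂ) (bsB a x))) := (Complex.continuous_conj.tendsto _).comp hB
  have h := ((bs_top ha hx).sub (hB.const_mul Complex.I)).add (hBc.const_mul Complex.I)
  have h2 := tendsto_nhds_unique (tendsto_const_nhds.congr' (f₁ := fun _ : ℝ => ∫ t in (-1:ℝ)..1, bsf a x t) (by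
    filter_upwards [eventually_ge_atTop 0] with R hR
    exact bs_rect ha R hR)) h
  rw [h2]
  simp

theorem bsJ_hasSum_big {ν x : ℝ} (hν : 1 / 2 < ν) (hx : 0 < x) :
    HasSum (fun m : ℕ => ((-1 : ℝ) ^ m / (m.factorial * Real.Gamma ((m : ℝ) + ν + 1))) *
      (x / 2) ^ (2 * (m : ℝ) + ν)) (2 * (bsK ν x).re) := by
  have h := bs_poisson hν hx
  have ha : 0 < ν - 1/2 := by linarith
  have e : ∫ t in (-1:ℝ)..1, Real.cos (x * t) * (1 - t ^ 2) ^ (ν - 1 / 2) =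
      2 * (-Complex.I * bsB (ν - 1/2) x).re := by
    have h1 := congrArg Complex.re (bs_contour ha hx)
    rw [Complex.add_re, Complex.conj_re, ← two_mul] at h1
    rw [← h1]
    have hInteg : IntervalIntegrable (fun t : ℝ => bsf (ν - 1/2) x t) MeasureTheory.volume (-1) 1 := by
      apply ContinuousOn.intervalIntegrable
      intro t ht
      rw [uIcc_of_le (by norm_num)] at ht
      refine ContinuousAt.continuousWithinAt ?_
      refine ContinuousAt.comp (f := fun t : ℝ => (t : ℂ)) (g := bsf (ν - 1/2) x) ?_ (by fun_prop)
      apply bsf_contOn ha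
      rw [bs_re_one_sub]
      simp only [Complex.ofReal_re, Complex.ofReal_im]
      nlinarith [ht.1, ht.2]
    have h2 := Complex.reCLM.intervalIntegral_comp_comm hInteg
    simp only [Complex.reCLM_apply] at h2
    rw [← h2]
    refine intervalIntegral.integral_congr fun t ht => ?_
    rw [uIcc_of_le (by norm_num)] at ht
    have h3 : 0 ≤ 1 - t ^ 2 := by nlinarith [ht.1, ht.2]
    unfold bsf
    have h4 : (1 - (t:ℂ) ^ 2) ^ ((ν - 1/2 : ℝ) : ℂ) = (((1 - t ^ 2) ^ (ν - 1/2) : ℝ) : ℂ) := by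
      rw [Complex.ofReal_cpow h3]; push_cast; rfl
    rw [h4, Complex.re_mul_ofReal]
    congr 1
    rw [show Complex.I * x * t = ((x * t : ℝ) : ℂ) * Complex.I by push_cast; ring, Complex.exp_ofReal_mul_I_re]
  rw [e] at h
  have e2 : 2 * (bsK ν x).re = bsC ν * x ^ ν * (2 * (-Complex.I * bsB (ν - 1/2) x).re) := by
    have : bsK ν x = ((bsC ν * x ^ ν : ℝ) : ℂ) * (-Complex.I * bsB (ν - 1/2) x) := by
      unfold bsK; ring
    rw [this, Complex.re_ofReal_mul]
    ring
  rw [e2]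
  exact h
theorem bs_down {P : ℝ → Prop} (h0 : ∀ ν, 1 / 2 < ν → P ν)
    (hs : ∀ ν, P ν → P (ν + 1) → P (ν - 1)) : ∀ ν, P ν := by
  have key : ∀ n : ℕ, ∀ ν : ℝ, 1 / 2 - n < ν → P ν := by
    intro n
    induction n with
    | zero => intro ν h; exact h0 ν (by simpa using h)
    | succ n ih =>
      intro ν h
      push_cast at h
      have := hs (ν + 1) (ih _ (by linarith)) (ih _ (by linarith))
      simpa using this
  intro ν
  obtain ⟨n, hn⟩ := exists_nat_gt (1 / 2 - ν)
  exact key n ν (by linarith)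

noncomputable def bsT (ν x : ℝ) (m : ℕ) : ℝ :=
  ((-1 : ℝ) ^ m / (m.factorial * Real.Gamma ((m : ℝ) + ν + 1))) * (x / 2) ^ (2 * (m : ℝ) + ν)

theorem bsJ_def (ν x : ℝ) : besselJ ν x = ∑' m, bsT ν x m := rfl

theorem bs_inv_Gamma (z : ℝ) : (Real.Gamma z)⁻¹ = z * (Real.Gamma (z + 1))⁻¹ := by
  rcases eq_or_ne z 0 with rfl | hz
  · simp
  · rw [Real.Gamma_add_one hz, mul_inv, mul_inv_cancel_left₀ hz]

theorem bsT_zero {ν x : ℝ} (hx : 0 < x) : bsT (ν - 1) x 0 = (2 * ν / x) * bsT ν x 0 := by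
  unfold bsT
  have h2 : 0 < x / 2 := by linarith
  simp only [pow_zero, Nat.factorial_zero, Nat.cast_one, one_mul, Nat.cast_zero, mul_zero, zero_add,
    one_div, sub_add_cancel]
  rw [bs_inv_Gamma ν, Real.rpow_sub h2, Real.rpow_one]
  field_simp

theorem bsT_succ {ν x : ℝ} (hx : 0 < x) (m : ℕ) :
    bsT (ν - 1) x (m + 1) = (2 * ν / x) * bsT ν x (m + 1) - bsT (ν + 1) x m := by
  unfold bsT
  have h2 : 0 < x / 2 := by linarith
  have e1 : (((m + 1 : ℕ) : ℝ) + (ν - 1) + 1) = m + ν + 1 := by push_cast; ring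
  have e2 : (((m + 1 : ℕ) : ℝ) + ν + 1) = m + ν + 1 + 1 := by push_cast; ring
  have e3 : ((m : ℝ) + (ν + 1) + 1) = m + ν + 1 + 1 := by ring
  have e4 : (x / 2) ^ (2 * ((m + 1 : ℕ) : ℝ) + (ν - 1)) = (x / 2) ^ (2 * (m : ℝ) + (ν + 1)) := by
    congr 1; push_cast; ring
  have e5 : (x / 2) ^ (2 * ((m + 1 : ℕ) : ℝ) + ν) = (x / 2) ^ (2 * (m : ℝ) + (ν + 1)) * (x / 2) := by
    rw [← Real.rpow_add_one h2.ne']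
    congr 1; push_cast; ring
  rw [e1, e2, e3, e4, e5, Nat.factorial_succ, div_eq_mul_inv, mul_inv, bs_inv_Gamma (m + ν + 1)]
  have h3 : ((m:ℝ) + 1) ≠ 0 := by positivity
  have h4 : (m.factorial : ℝ) ≠ 0 := by positivity
  push_cast
  simp only [div_eq_mul_inv, mul_inv]
  generalize (Real.Gamma (m + ν + 1 + 1))⁻¹ = G
  field_simp
  ring

theorem bsT_summable {x : ℝ} (hx : 0 < x) : ∀ ν, Summable (bsT ν x) := by
  apply bs_down
  · intro ν hν
    exact (bsJ_hasSum_big hν hx).summable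
  · intro ν h1 h2
    rw [← summable_nat_add_iff 1]
    simp_rw [bsT_succ hx]
    exact (((summable_nat_add_iff 1).mpr h1).mul_left _).sub h2

theorem bsJ_rec {x : ℝ} (hx : 0 < x) (ν : ℝ) :
    besselJ (ν - 1) x = 2 * ν / x * besselJ ν x - besselJ (ν + 1) x := by
  have hs := bsT_summable hx
  rw [bsJ_def, bsJ_def, bsJ_def, (hs (ν - 1)).tsum_eq_zero_add, (hs ν).tsum_eq_zero_add,
    bsT_zero hx]
  simp_rw [bsT_succ hx]
  rw [Summable.tsum_sub (((summable_nat_add_iff 1).mpr (hs ν)).mul_left _) (hs (ν + 1)), tsum_mul_left]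
  ring

theorem bsJ_big {ν x : ℝ} (hν : 1 / 2 < ν) (hx : 0 < x) : besselJ ν x = 2 * (bsK ν x).re :=
  (bsJ_hasSum_big hν hx).tsum_eq

theorem bs_re_deriv {f : ℝ → ℂ} {f' : ℂ} {x : ℝ} (h : HasDerivAt f f' x) :
    HasDerivAt (fun x => (f x).re) f'.re x :=
  Complex.reCLM.hasFDerivAt.comp_hasDerivAt x h

theorem bs_im_deriv {f : ℝ → ℂ} {f' : ℂ} {x : ℝ} (h : HasDerivAt f f' x) :
    HasDerivAt (fun x => (f x).im) f'.im x :=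
  Complex.imCLM.hasFDerivAt.comp_hasDerivAt x h

theorem bsJ_deriv : ∀ ν : ℝ, ∀ x : ℝ, 0 < x →
    HasDerivAt (besselJ ν) (ν / x * besselJ ν x - besselJ (ν + 1) x) x := by
  apply bs_down
  · intro ν hν x hx
    have h := (bs_re_deriv (bsK_deriv hν hx)).const_mul 2
    have h2 : besselJ ν =ᶠ[𝓝 x] fun x => 2 * (bsK ν x).re := by
      filter_upwards [Ioi_mem_nhds hx] with y hy
      exact bsJ_big hν hy
    refine (h.congr_of_eventuallyEq h2).congr_deriv ?_
    rw [bsJ_big hν hx, bsJ_big (by linarith) hx, Complex.sub_re, Complex.re_ofReal_mul]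
    ring
  · intro ν h1 h2 x hx
    have h3 : besselJ (ν - 1) =ᶠ[𝓝 x] fun x => 2 * ν * x⁻¹ * besselJ ν x - besselJ (ν + 1) x := by
      filter_upwards [Ioi_mem_nhds hx] with y hy
      rw [bsJ_rec hy, div_eq_mul_inv]
    have h4 := ((((hasDerivAt_inv hx.ne').const_mul (2 * ν)).mul (h1 x hx)).sub (h2 x hx))
    refine (h4.congr_of_eventuallyEq h3).congr_deriv ?_
    have h5 := bsJ_rec hx (ν + 1)
    rw [add_sub_cancel_right] at h5
    have h6 : besselJ (ν + 1 + 1) x = 2 * (ν + 1) / x * besselJ (ν + 1) x - besselJ ν x := by linarith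
    rw [bsJ_rec hx ν, h6, sub_add_cancel]
    field_simp
    ring

theorem bsJ_cont {x : ℝ} (hx : 0 < x) : ∀ ν : ℝ, ContinuousAt (fun ν => besselJ ν x) ν := by
  apply bs_down
  · intro ν hν
    have h := bsK_cont_nu hν hx
    have h1 : ContinuousAt (fun ν => 2 * (bsK ν x).re) ν :=
      continuousAt_const.mul (Complex.continuous_re.continuousAt.comp h)
    refine h1.congr ?_
    filter_upwards [Ioi_mem_nhds hν] with y hy
    rw [bsJ_big hy hx]
  · intro ν h1 h2
    have e : (fun ν => besselJ ν x) =
        fun ν => 2 * (ν + 1) / x * besselJ (ν + 1) x - besselJ (ν + 1 + 1) x := by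
      funext ν
      have := bsJ_rec hx (ν + 1)
      rwa [add_sub_cancel_right] at this
    rw [e]
    have c1 : ContinuousAt (fun ν => besselJ (ν + 1) x) (ν - 1) :=
      ContinuousAt.comp_of_eq (f := fun ν : ℝ => ν + 1) (g := fun ν => besselJ ν x) h1 (by fun_prop) (by ring)
    have c2 : ContinuousAt (fun ν => besselJ (ν + 1 + 1) x) (ν - 1) :=
      ContinuousAt.comp_of_eq (f := fun ν : ℝ => ν + 1 + 1) (g := fun ν => besselJ ν x) h2 (by fun_prop) (by ring)
    exact (ContinuousAt.mul (by fun_prop) c1).sub c2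

/-- `√x f(x) = √(2/π) (a cos x + b sin x) + o(1)`. -/
def BsAsym (f : ℝ → ℝ) (a b : ℝ) : Prop :=
  Tendsto (fun x => √x * f x - √(2 / π) * (a * Real.cos x + b * Real.sin x)) atTop (𝓝 0)

theorem BsAsym.lin {f g : ℝ → ℝ} {a b a' b' : ℝ} (hf : BsAsym f a b) (hg : BsAsym g a' b') (c d : ℝ) :
    BsAsym (fun x => c * f x + d * g x) (c * a + d * a') (c * b + d * b') := by
  have := (Tendsto.const_mul c hf).add (Tendsto.const_mul d hg)
  unfold BsAsym
  simp only [mul_zero, add_zero] at this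
  refine this.congr fun x => ?_
  ring

theorem BsAsym.congr {f g : ℝ → ℝ} {a b : ℝ} (hf : BsAsym f a b) (h : ∀ x, 0 < x → g x = f x) :
    BsAsym g a b := by
  refine Tendsto.congr' ?_ hf
  filter_upwards [eventually_gt_atTop 0] with x hx
  rw [h x hx]

theorem BsAsym.decay {f : ℝ → ℝ} {a b : ℝ} (hf : BsAsym f a b) (c : ℝ) :
    BsAsym (fun x => c / x * f x) 0 0 := by
  have hb : Tendsto (fun x : ℝ => c / x) atTop (𝓝 0) := tendsto_const_nhds.div_atTop tendsto_id
  have h1 := hb.mul hf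
  have h2 : Tendsto (fun x : ℝ => c / x * (√(2 / π) * (a * Real.cos x + b * Real.sin x))) atTop (𝓝 0) := by
    refine hb.zero_mul_isBoundedUnder_le ?_
    refine isBoundedUnder_of ⟨√(2/π) * (|a| + |b|), fun x => ?_⟩
    simp only [Function.comp, Real.norm_eq_abs]
    rw [abs_mul, abs_of_nonneg (Real.sqrt_nonneg _)]
    gcongr
    refine (abs_add_le _ _).trans ?_
    rw [abs_mul, abs_mul]
    have := Real.abs_cos_le_one x
    have := Real.abs_sin_le_one x
    gcongr <;> nlinarith [abs_nonneg a, abs_nonneg b]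
  have h3 := h1.add h2
  simp only [mul_zero, add_zero] at h3
  unfold BsAsym
  refine h3.congr fun x => ?_
  ring

noncomputable def bsPhi (ν : ℝ) : ℝ := ν * π / 2 + π / 4

theorem bsK_asym {ν : ℝ} (hν : 1 / 2 < ν) :
    Tendsto (fun x : ℝ => 2 * (√x : ℂ) * bsK ν x -
      (√(2 / π) : ℂ) * Complex.exp (((x - bsPhi ν : ℝ) : ℂ) * Complex.I)) atTop (𝓝 0) := by
  have h := bsK_asymp hν
  rw [← tendsto_sub_nhds_zero_iff] at h
  rw [tendsto_zero_iff_norm_tendsto_zero] at h ⊢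
  have h2 := h.const_mul 2
  rw [mul_zero] at h2
  refine h2.congr fun x => ?_
  have e : 2 * (√x : ℂ) * bsK ν x - (√(2 / π) : ℂ) * Complex.exp (((x - bsPhi ν : ℝ) : ℂ) * Complex.I) =
      2 * Complex.exp ((x : ℂ) * Complex.I) * ((√x : ℂ) * Complex.exp (-(Complex.I * x)) * bsK ν x -
      (((√(2 / π) / 2 : ℝ) : ℂ) * Complex.exp (-(((ν + 1 / 2) * π / 2 : ℝ) : ℂ) * Complex.I))) := by
    have e1 : Complex.exp (((x - bsPhi ν : ℝ) : ℂ) * Complex.I) = Complex.exp ((x : ℂ) * Complex.I) *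
        Complex.exp (-(((ν + 1 / 2) * π / 2 : ℝ) : ℂ) * Complex.I) := by
      rw [← Complex.exp_add]
      congr 1
      unfold bsPhi
      push_cast
      ring
    have e2 : Complex.exp ((x : ℂ) * Complex.I) * Complex.exp (-(Complex.I * x)) = 1 := by
      rw [← Complex.exp_add, mul_comm Complex.I, add_neg_cancel, Complex.exp_zero]
    rw [e1]
    push_cast
    linear_combination (-2 * (√x : ℂ) * bsK ν x) * e2
  rw [e, norm_mul, norm_mul, Complex.norm_exp_ofReal_mul_I]
  simp

theorem bsK_asym_re {ν : ℝ} (hν : 1 / 2 < ν) :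
    BsAsym (fun x => 2 * (bsK ν x).re) (Real.cos (bsPhi ν)) (Real.sin (bsPhi ν)) := by
  have h := (Complex.continuous_re.tendsto 0).comp (bsK_asym hν)
  unfold BsAsym
  rw [Complex.zero_re] at h
  refine h.congr fun x => ?_
  simp only [Function.comp]
  rw [Complex.sub_re, show 2 * (√x : ℂ) * bsK ν x = ((2 * √x : ℝ) : ℂ) * bsK ν x by push_cast; ring,
    Complex.re_ofReal_mul, Complex.re_ofReal_mul, Complex.exp_ofReal_mul_I_re, Real.cos_sub]
  ring

theorem bsK_asym_im {ν : ℝ} (hν : 1 / 2 < ν) :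
    BsAsym (fun x => 2 * (bsK ν x).im) (-Real.sin (bsPhi ν)) (Real.cos (bsPhi ν)) := by
  have h := (Complex.continuous_im.tendsto 0).comp (bsK_asym hν)
  unfold BsAsym
  rw [Complex.zero_im] at h
  refine h.congr fun x => ?_
  simp only [Function.comp]
  rw [Complex.sub_im, show 2 * (√x : ℂ) * bsK ν x = ((2 * √x : ℝ) : ℂ) * bsK ν x by push_cast; ring,
    Complex.im_ofReal_mul, Complex.im_ofReal_mul, Complex.exp_ofReal_mul_I_im, Real.sin_sub]
  ring

theorem bsPhi_add (ν : ℝ) : bsPhi (ν + 1) = bsPhi ν + π / 2 := by unfold bsPhi; ring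
theorem bsPhi_sub (ν : ℝ) : bsPhi (ν - 1) = bsPhi ν - π / 2 := by unfold bsPhi; ring

theorem bsJ_asym : ∀ ν : ℝ, BsAsym (besselJ ν) (Real.cos (bsPhi ν)) (Real.sin (bsPhi ν)) := by
  apply bs_down
  · intro ν hν
    exact (bsK_asym_re hν).congr fun x hx => bsJ_big hν hx
  · intro ν h1 h2
    have h := ((h1.decay (2 * ν)).lin h2 1 (-1)).congr (g := besselJ (ν - 1)) (fun x hx => by
      rw [bsJ_rec hx]; ring)
    rw [bsPhi_add, Real.cos_add_pi_div_two, Real.sin_add_pi_div_two] at h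
    rw [bsPhi_sub, Real.cos_sub_pi_div_two, Real.sin_sub_pi_div_two]
    simpa using h
noncomputable def bsTrig (a b x : ℝ) : ℝ := √(2 / π) * (a * Real.cos x + b * Real.sin x)

theorem bsTrig_bdd (a b : ℝ) :
    IsBoundedUnder (· ≤ ·) atTop (norm ∘ bsTrig a b) := by
  refine isBoundedUnder_of ⟨√(2/π) * (|a| + |b|), fun x => ?_⟩
  simp only [Function.comp, Real.norm_eq_abs, bsTrig]
  rw [abs_mul, abs_of_nonneg (Real.sqrt_nonneg _)]
  gcongr
  refine (abs_add_le _ _).trans ?_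
  rw [abs_mul, abs_mul]
  have := Real.abs_cos_le_one x
  have := Real.abs_sin_le_one x
  gcongr <;> nlinarith [abs_nonneg a, abs_nonneg b]

theorem BsAsym.mul {f g : ℝ → ℝ} {a b p q : ℝ} (hf : BsAsym f a b) (hg : BsAsym g p q) :
    Tendsto (fun x => (√x * f x) * (√x * g x) - bsTrig a b x * bsTrig p q x) atTop (𝓝 0) := by
  have hf' : Tendsto (fun x => √x * f x - bsTrig a b x) atTop (𝓝 0) := hf
  have hg' : Tendsto (fun x => √x * g x - bsTrig p q x) atTop (𝓝 0) := hg
  have h1 := hf'.mul hg'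
  have h2 := hf'.zero_mul_isBoundedUnder_le (bsTrig_bdd p q)
  have h3 := hg'.zero_mul_isBoundedUnder_le (bsTrig_bdd a b)
  have h := (h1.add h2).add h3
  simp only [mul_zero, add_zero] at h
  refine h.congr fun x => ?_
  ring

theorem bs_wronsk {f f1 g g1 : ℝ → ℝ} {a b p q : ℝ} (hf : BsAsym f a b) (hf1 : BsAsym f1 (-b) a)
    (hg : BsAsym g p q) (hg1 : BsAsym g1 (-q) p) :
    Tendsto (fun x => x * (f x * g1 x - f1 x * g x)) atTop (𝓝 (2 / π * (b * p - a * q))) := by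
  have h := (hf.mul hg1).sub (hf1.mul hg)
  rw [sub_zero] at h
  have h2 := h.add_const (2 / π * (b * p - a * q))
  rw [zero_add] at h2
  refine h2.congr' ?_
  filter_upwards [eventually_gt_atTop 0] with x hx
  have e1 : √x * √x = x := Real.mul_self_sqrt hx.le
  have e2 : √(2 / π) * √(2 / π) = 2 / π := Real.mul_self_sqrt (by positivity)
  have e3 := Real.sin_sq_add_cos_sq x
  unfold bsTrig
  linear_combination (f x * g1 x - f1 x * g x) * e1
    - (b * p - a * q) * (Real.sin x ^ 2 + Real.cos x ^ 2) * e2 - (b * p - a * q) * (2 / π) * e3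

structure BsSol (ν : ℝ) (f g : ℝ → ℝ) (a b : ℝ) : Prop where
  df : ∀ x, 0 < x → HasDerivAt f (ν / x * f x - g x) x
  dg : ∀ x, 0 < x → HasDerivAt g (f x - (ν + 1) / x * g x) x
  af : BsAsym f a b
  ag : BsAsym g (-b) a

theorem BsSol.lin {ν : ℝ} {f g f1 g1 : ℝ → ℝ} {a b p q : ℝ} (h : BsSol ν f f1 a b)
    (k : BsSol ν g g1 p q) (c d : ℝ) :
    BsSol ν (fun x => c * f x + d * g x) (fun x => c * f1 x + d * g1 x)
      (c * a + d * p) (c * b + d * q) where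
  df x hx := (((h.df x hx).const_mul c).add ((k.df x hx).const_mul d)).congr_deriv (by ring)
  dg x hx := (((h.dg x hx).const_mul c).add ((k.dg x hx).const_mul d)).congr_deriv (by ring)
  af := h.af.lin k.af c d
  ag := by
    have := h.ag.lin k.ag c d
    rwa [show c * -b + d * -q = -(c * b + d * q) by ring] at this

theorem BsSol.const {ν : ℝ} {f g f1 g1 : ℝ → ℝ} {a b p q : ℝ} (h : BsSol ν f f1 a b)
    (k : BsSol ν g g1 p q) {x : ℝ} (hx : 0 < x) :
    x * (f x * g1 x - f1 x * g x) = 2 / π * (b * p - a * q) := by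
  have hd : ∀ y, 0 < y → HasDerivAt (fun x => x * (f x * g1 x - f1 x * g x)) 0 y := by
    intro y hy
    have := (hasDerivAt_id y).mul (((h.df y hy).mul (k.dg y hy)).sub ((h.dg y hy).mul (k.df y hy)))
    refine this.congr_deriv ?_
    simp only [Pi.mul_apply, Pi.sub_apply, id]
    field_simp
    ring
  have hc : ∀ y, 0 < y → y * (f y * g1 y - f1 y * g y) = x * (f x * g1 x - f1 x * g x) := by
    intro y hy
    exact isOpen_Ioi.is_const_of_deriv_eq_zero (𝕜 := ℝ) (s := Ioi (0:ℝ))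
      (f := fun x => x * (f x * g1 x - f1 x * g x)) isPreconnected_Ioi
      (fun z hz => (hd z hz).differentiableAt.differentiableWithinAt)
      (fun z hz => (hd z hz).deriv) hy hx
  refine tendsto_nhds_unique ?_ (bs_wronsk h.af h.ag k.af k.ag)
  refine tendsto_const_nhds.congr' ?_
  filter_upwards [eventually_gt_atTop 0] with y hy
  exact (hc y hy).symm

theorem bsSol_J (ν : ℝ) :
    BsSol ν (besselJ ν) (besselJ (ν + 1)) (Real.cos (bsPhi ν)) (Real.sin (bsPhi ν)) where
  df x hx := bsJ_deriv ν x hx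
  dg x hx := by
    refine (bsJ_deriv (ν + 1) x hx).congr_deriv ?_
    have h5 := bsJ_rec hx (ν + 1)
    rw [add_sub_cancel_right] at h5
    rw [h5]
    ring
  af := bsJ_asym ν
  ag := by
    have := bsJ_asym (ν + 1)
    rwa [bsPhi_add, Real.cos_add_pi_div_two, Real.sin_add_pi_div_two] at this

theorem bsSol_Jneg (ν : ℝ) :
    BsSol ν (besselJ (-ν)) (fun x => -besselJ (-ν - 1) x)
      (Real.cos (bsPhi (-ν))) (Real.sin (bsPhi (-ν))) where
  df x hx := by
    refine (bsJ_deriv (-ν) x hx).congr_deriv ?_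
    rw [bsJ_rec hx (-ν)]
    ring
  dg x hx := by
    refine (bsJ_deriv (-ν - 1) x hx).neg.congr_deriv ?_
    rw [sub_add_cancel]
    ring
  af := bsJ_asym (-ν)
  ag := by
    have h := (bsJ_asym (-ν - 1)).lin (bsJ_asym (-ν - 1)) (-1) 0
    rw [bsPhi_sub, Real.cos_sub_pi_div_two, Real.sin_sub_pi_div_two] at h
    simpa using h

theorem bsSol_K {ν : ℝ} (hν : 1 / 2 < ν) :
    BsSol ν (fun x => 2 * (bsK ν x).im) (fun x => 2 * (bsK (ν + 1) x).im)
      (-Real.sin (bsPhi ν)) (Real.cos (bsPhi ν)) where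
  df x hx := by
    refine ((bs_im_deriv (bsK_deriv hν hx)).const_mul 2).congr_deriv ?_
    rw [Complex.sub_im, Complex.im_ofReal_mul]
    ring
  dg x hx := by
    refine ((bs_im_deriv (bsK_rec hν hx)).const_mul 2).congr_deriv ?_
    rw [Complex.sub_im, Complex.im_ofReal_mul]
    ring
  af := bsK_asym_im hν
  ag := by
    have := bsK_asym_im (ν := ν + 1) (by linarith)
    rwa [bsPhi_add, Real.cos_add_pi_div_two, Real.sin_add_pi_div_two] at this

theorem bs_unique {ν : ℝ} (hν : 1 / 2 < ν) {f f1 : ℝ → ℝ}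
    (h : BsSol ν f f1 (-Real.sin (bsPhi ν)) (Real.cos (bsPhi ν))) {x : ℝ} (hx : 0 < x) :
    f x = 2 * (bsK ν x).im := by
  have D := h.lin (bsSol_K hν) 1 (-1)
  have c1 := (bsSol_J ν).const D hx
  have c2 := (bsSol_K hν).const D hx
  have c3 := (bsSol_J ν).const (bsSol_K hν) hx
  have e := Real.sin_sq_add_cos_sq (bsPhi ν)
  have hc3 : x * (besselJ ν x * (2 * (bsK (ν + 1) x).im) - besselJ (ν + 1) x * (2 * (bsK ν x).im))
      = - (2 / π) := by
    rw [c3]; linear_combination (-2 / π) * e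
  have hpi : (2 / π) ≠ 0 := by positivity
  have key : (1 * f x + -1 * (2 * (bsK ν x).im)) * (2 / π) = 0 := by
    linear_combination (1 * f x + -1 * (2 * (bsK ν x).im)) * hc3 - (2 * (bsK ν x).im) * c1
      + besselJ ν x * c2
  have := (mul_eq_zero.mp key).resolve_right hpi
  linarith

/-- The quotient in the definition of `Y`, as a solution. -/
theorem bsSol_Q {ν : ℝ} (hs : Real.sin (ν * π) ≠ 0) :
    ∃ g, BsSol ν (fun x => (besselJ ν x * Real.cos (ν * π) - besselJ (-ν) x) / Real.sin (ν * π)) g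
      (-Real.sin (bsPhi ν)) (Real.cos (bsPhi ν)) := by
  have h := (bsSol_J ν).lin (bsSol_Jneg ν) (Real.cos (ν * π) / Real.sin (ν * π))
    (-1 / Real.sin (ν * π))
  refine ⟨fun x => Real.cos (ν * π) / Real.sin (ν * π) * besselJ (ν + 1) x +
    -1 / Real.sin (ν * π) * -besselJ (-ν - 1) x, ?_⟩
  · convert h using 1
    · funext x; field_simp; ring
    · have e : bsPhi (-ν) = bsPhi ν - ν * π := by unfold bsPhi; ring
      rw [e, Real.cos_sub]
      field_simp
      ring
    · have e : bsPhi (-ν) = bsPhi ν - ν * π := by unfold bsPhi; ring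
      rw [e, Real.sin_sub]
      field_simp
      ring

theorem bs_sin_ne {ν : ℝ} (h : ∀ n : ℤ, ν ≠ (n : ℝ)) : Real.sin (ν * π) ≠ 0 := by
  intro h0
  obtain ⟨n, hn⟩ := Real.sin_eq_zero_iff.mp h0
  exact h n (mul_right_cancel₀ Real.pi_ne_zero hn.symm)

theorem bs_neBot (ν : ℝ) : (𝓝[{μ : ℝ | ∀ n : ℤ, μ ≠ (n : ℝ)}] ν).NeBot := by
  rw [← mem_closure_iff_nhdsWithin_neBot]
  have h : (range ((↑) : ℤ → ℝ))ᶜ = {μ : ℝ | ∀ n : ℤ, μ ≠ (n : ℝ)} := by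
    ext y
    simp [eq_comm]
  rw [← h]
  exact (countable_range _).dense_compl ℝ ν

theorem bsY_big {ν x : ℝ} (hν : 1 / 2 < ν) (hx : 0 < x) : besselY ν x = 2 * (bsK ν x).im := by
  have := bs_neBot ν
  unfold besselY
  refine Tendsto.limUnder_eq ?_
  have h1 : ContinuousAt (fun ν => 2 * (bsK ν x).im) ν :=
    continuousAt_const.mul (Complex.continuous_im.continuousAt.comp (bsK_cont_nu hν hx))
  refine Tendsto.congr' ?_ (h1.tendsto.mono_left nhdsWithin_le_nhds)
  filter_upwards [self_mem_nhdsWithin, nhdsWithin_le_nhds (Ioi_mem_nhds hν)] with μ h2 h3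
  obtain ⟨g, hg⟩ := bsSol_Q (bs_sin_ne h2)
  exact (bs_unique h3 hg hx).symm

theorem bsY_small {ν x : ℝ} (hs : Real.sin (ν * π) ≠ 0) (hx : 0 < x) : besselY ν x =
    (besselJ ν x * Real.cos (ν * π) - besselJ (-ν) x) / Real.sin (ν * π) := by
  have := bs_neBot ν
  unfold besselY
  refine Tendsto.limUnder_eq ?_
  have c1 := bsJ_cont hx ν
  have c2 : ContinuousAt (fun ν => besselJ (-ν) x) ν :=
    ContinuousAt.comp (f := fun ν : ℝ => -ν) (g := fun ν => besselJ ν x) (bsJ_cont hx (-ν)) (by fun_prop)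
  have h1 : ContinuousAt (fun ν => (besselJ ν x * Real.cos (ν * π) - besselJ (-ν) x) /
      Real.sin (ν * π)) ν :=
    ((c1.mul (by fun_prop)).sub c2).div (by fun_prop) hs
  exact h1.tendsto.mono_left nhdsWithin_le_nhds

theorem bsSol_congr {ν a b : ℝ} {f f' g : ℝ → ℝ} (h : BsSol ν f g a b)
    (e : ∀ x, 0 < x → f' x = f x) : BsSol ν f' g a b where
  df x hx := by
    have h2 : f' =ᶠ[𝓝 x] f := by
      filter_upwards [Ioi_mem_nhds hx] with y hy
      exact e y hy
    rw [e x hx]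
    exact (h.df x hx).congr_of_eventuallyEq h2
  dg x hx := by
    rw [e x hx]
    exact h.dg x hx
  af := h.af.congr e
  ag := h.ag

theorem bsSol_Y {ν : ℝ} (hν : 0 < ν) :
    ∃ g, BsSol ν (besselY ν) g (-Real.sin (bsPhi ν)) (Real.cos (bsPhi ν)) := by
  rcases lt_or_ge (1 / 2) ν with h | h
  · exact ⟨_, bsSol_congr (bsSol_K h) fun x hx => bsY_big h hx⟩
  · have hs : Real.sin (ν * π) ≠ 0 := by
      refine (Real.sin_pos_of_pos_of_lt_pi (by positivity) ?_).ne'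
      nlinarith [Real.pi_pos]
    obtain ⟨g, hg⟩ := bsSol_Q hs
    exact ⟨g, bsSol_congr hg fun x hx => bsY_small hs hx⟩

theorem bsSol_cyl (δ : ℝ) {ν : ℝ} (hν : 0 < ν) :
    ∃ g, BsSol ν (cylinder δ ν) g (Real.cos (bsPhi ν - δ)) (Real.sin (bsPhi ν - δ)) := by
  obtain ⟨g, hg⟩ := bsSol_Y hν
  have h := (bsSol_J ν).lin hg (Real.cos δ) (-Real.sin δ)
  refine ⟨fun x => Real.cos δ * besselJ (ν + 1) x + -Real.sin δ * g x, ?_⟩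
  · convert h using 1
    · funext x; unfold cylinder; ring
    · rw [Real.cos_sub]; ring
    · rw [Real.sin_sub]; ring

theorem bs_sqrt_deriv {ν a b x : ℝ} {f g : ℝ → ℝ} (h : BsSol ν f g a b) (hx : 0 < x) :
    HasDerivAt (fun x => √x * f x) (1 / (2 * √x) * f x + √x * (ν / x * f x - g x)) x :=
  (Real.hasDerivAt_sqrt hx.ne').mul (h.df x hx)

/-- Asymptotics of the Wronskian of `ξ_ν = √x C_ν` and `ξ̄_μ = √x C̄_μ`:
`W(x) → (2/π) sin(((μ−ν)/2)π + δ − δ̄)` as `x → ∞`. -/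
theorem wronskian_tendsto_atTop (δ δ' ν μ : ℝ) (hν : 0 < ν) (hμ : 0 < μ)
    (ξ ξ' W : ℝ → ℝ)
    (hξ : ξ = fun x => Real.sqrt x * cylinder δ ν x)
    (hξ' : ξ' = fun x => Real.sqrt x * cylinder δ' μ x)
    (hW : W = fun x => ξ x * deriv ξ' x - deriv ξ x * ξ' x) :
    Tendsto W atTop (𝓝 (2 / π * Real.sin ((μ - ν) / 2 * π + δ - δ'))) := by
  obtain ⟨g, hg⟩ := bsSol_cyl δ hν
  obtain ⟨k, hk⟩ := bsSol_cyl δ' hμ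
  have h1 := bs_wronsk hg.af hg.ag hk.af hk.ag
  have h2 := (hg.af.decay (μ - ν)).mul hk.af
  have h3 := h2.sub h1
  have hlim : 0 - 2 / π * (Real.sin (bsPhi ν - δ) * Real.cos (bsPhi μ - δ') -
      Real.cos (bsPhi ν - δ) * Real.sin (bsPhi μ - δ')) =
      2 / π * Real.sin ((μ - ν) / 2 * π + δ - δ') := by
    rw [show (μ - ν) / 2 * π + δ - δ' = (bsPhi μ - δ') - (bsPhi ν - δ) by unfold bsPhi; ring,
      Real.sin_sub (bsPhi μ - δ') (bsPhi ν - δ)]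
    ring
  rw [hlim] at h3
  refine h3.congr' ?_
  filter_upwards [eventually_gt_atTop 0] with x hx
  rw [hW, hξ, hξ']
  have e1 : √x * √x = x := Real.mul_self_sqrt hx.le
  have hs : √x ≠ 0 := (Real.sqrt_pos.mpr hx).ne'
  simp only [(bs_sqrt_deriv hg hx).deriv, (bs_sqrt_deriv hk hx).deriv]
  have e2 : bsTrig 0 0 x = 0 := by simp [bsTrig]
  rw [e2, zero_mul, sub_zero]
  generalize cylinder δ ν x = C
  generalize cylinder δ' μ x = D
  generalize √x = s at *
  subst e1
  field_simp
  ring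
end

section
/- Let δ be a fixed real number and ν > 0. Then x^ν·C_ν(x) converges to sin(δ)·Γ(ν)·2^ν/π as x → 0 from the right, where Γ is the real Gamma function; equivalently, C_ν(x) = sin(δ)·(Γ(ν)·2^ν/π + o(1))·x^{−ν} as x → 0+. -/
open Real Filter Topology Set

lemma gamma_inv_bound (c : ℂ) : ∃ M : ℝ, 0 ≤ M ∧ ∀ m : ℕ, ∀ z ∈ Metric.closedBall c 2,
    ‖(Complex.Gamma (z + m + 2))⁻¹‖ ≤ M := by
  have hb : ∀ m : ℕ, ∃ M : ℝ, ∀ z ∈ Metric.closedBall c 2,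
      ‖(Complex.Gamma (z + m + 2))⁻¹‖ ≤ M := by
    intro m
    have hc : Continuous fun z : ℂ => (Complex.Gamma (z + m + 2))⁻¹ :=
      Complex.differentiable_one_div_Gamma.continuous.comp (by fun_prop)
    exact (isCompact_closedBall c 2).exists_bound_of_continuousOn hc.continuousOn
  choose B hB using hb
  obtain ⟨N, hN⟩ := exists_nat_ge (‖c‖ + 3)
  have hM : ∃ M : ℝ, 0 ≤ M ∧ ∀ m ≤ N, B m ≤ M := by
    refine ⟨∑ i ∈ Finset.range (N + 1), |B i|, Finset.sum_nonneg fun i _ => abs_nonneg _, ?_⟩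
    intro m hm
    refine (le_abs_self _).trans ?_
    exact Finset.single_le_sum (f := fun i => |B i|) (fun i _ => abs_nonneg _)
      (Finset.mem_range.2 (by omega))
  obtain ⟨M, hM0, hM⟩ := hM
  refine ⟨M, hM0, ?_⟩
  intro m
  induction m with
  | zero => intro z hz; exact (hB 0 z hz).trans (hM 0 (Nat.zero_le _))
  | succ k ih =>
    intro z hz
    by_cases hk : k + 1 ≤ N
    · exact (hB _ z hz).trans (hM _ hk)
    · have hkN : (N : ℝ) ≤ k := by exact_mod_cast (by omega : N ≤ k)
      have hz' : ‖z‖ ≤ ‖c‖ + 2 := by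
        have := norm_le_of_mem_closedBall hz
        simpa using this
      have h1 : 1 ≤ ‖z + k + 2‖ := by
        have h2 : ‖((k : ℂ) + 2)‖ ≤ ‖z + k + 2‖ + ‖z‖ := by
          have : ((k : ℂ) + 2) = (z + k + 2) - z := by ring
          rw [this]
          exact norm_sub_le _ _
        have h3 : ‖((k : ℂ) + 2)‖ = k + 2 := by
          have : ((k : ℂ) + 2) = ((k + 2 : ℕ) : ℂ) := by push_cast; ring
          rw [this, Complex.norm_natCast]; push_cast; ring
        linarith
      have h0 : z + k + 2 ≠ 0 := by
        intro h; rw [h] at h1; norm_num at h1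
      have : z + ((k + 1 : ℕ) : ℂ) + 2 = (z + k + 2) + 1 := by push_cast; ring
      rw [this, Complex.Gamma_add_one _ h0, mul_inv, norm_mul, norm_inv]
      calc ‖z + k + 2‖⁻¹ * ‖(Complex.Gamma (z + k + 2))⁻¹‖ ≤ 1 * M := by
            gcongr
            · exact inv_le_one_of_one_le₀ h1
            · exact ih z hz
        _ = M := one_mul M

/-- termwise coefficients -/
noncomputable def psiC (t : ℝ) (z : ℂ) : ℂ :=
  ∑' m : ℕ, ((-1 : ℂ) ^ (m + 1) / ((m + 1).factorial : ℂ)) * (t : ℂ) ^ m *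
    (Complex.Gamma (z + m + 2))⁻¹

lemma psiC_term_bound {M t : ℝ} (ht : 0 ≤ t) (ht1 : t ≤ 1) (m : ℕ) (g : ℂ)
    (hg : ‖g‖ ≤ M) :
    ‖((-1 : ℂ) ^ (m + 1) / ((m + 1).factorial : ℂ)) * (t : ℂ) ^ m * g‖
      ≤ M * (1 / (m.factorial : ℝ)) := by
  rw [norm_mul, norm_mul, norm_div, norm_pow, norm_pow, norm_neg, norm_one, one_pow,
    Complex.norm_natCast, Complex.norm_real, Real.norm_of_nonneg ht, mul_comm M]
  have h1 : t ^ m ≤ 1 := pow_le_one₀ ht ht1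
  have h2 : 1 / ((m + 1).factorial : ℝ) ≤ 1 / (m.factorial : ℝ) := by
    apply one_div_le_one_div_of_le
    · exact_mod_cast m.factorial_pos
    · exact_mod_cast Nat.factorial_le (Nat.le_succ m)
  have h3 : 0 ≤ t ^ m := pow_nonneg ht m
  calc 1 / ((m + 1).factorial : ℝ) * t ^ m * ‖g‖ ≤ 1 / (m.factorial : ℝ) * 1 * M := by
        gcongr
    _ = _ := by ring

lemma psiC_props (c : ℂ) : ∃ K : ℝ, ∀ t : ℝ, 0 ≤ t → t ≤ 1 →
    HasDerivAt (psiC t) (deriv (psiC t) c) c ∧ ‖deriv (psiC t) c‖ ≤ K ∧ ‖psiC t c‖ ≤ K := by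
  obtain ⟨M, hM0, hM⟩ := gamma_inv_bound c
  have hs : Summable fun m : ℕ => M * (1 / (m.factorial : ℝ)) := by
    have := (Real.summable_pow_div_factorial 1).mul_left M
    simpa using this
  refine ⟨∑' m : ℕ, M * (1 / (m.factorial : ℝ)), ?_⟩
  intro t ht ht1
  have hterm : ∀ m : ℕ, ∀ z ∈ Metric.closedBall c 2,
      ‖((-1 : ℂ) ^ (m + 1) / ((m + 1).factorial : ℂ)) * (t : ℂ) ^ m *
        (Complex.Gamma (z + m + 2))⁻¹‖ ≤ M * (1 / (m.factorial : ℝ)) :=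
    fun m z hz => psiC_term_bound ht ht1 m _ (hM m z hz)
  have hbd : ∀ z ∈ Metric.closedBall c 2, ‖psiC t z‖ ≤ ∑' m : ℕ, M * (1 / (m.factorial : ℝ)) :=
    fun z hz => tsum_of_norm_bounded hs.hasSum (fun m => hterm m z hz)
  have hd : DifferentiableOn ℂ (psiC t) (Metric.ball c 2) := by
    refine Complex.differentiableOn_tsum_of_summable_norm hs ?_ Metric.isOpen_ball ?_
    · intro m
      apply Differentiable.differentiableOn
      refine Differentiable.const_mul ?_ _
      exact Complex.differentiable_one_div_Gamma.comp (by fun_prop)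
    · intro m w hw
      exact hterm m w (Metric.ball_subset_closedBall hw)
  refine ⟨?_, ?_, ?_⟩
  · exact (hd.differentiableAt (Metric.isOpen_ball.mem_nhds (Metric.mem_ball_self (by norm_num)))).hasDerivAt
  · have := Complex.norm_deriv_le_of_forall_mem_sphere_norm_le (c := c) (R := 1) one_pos
      (hd.diffContOnCl_ball (Metric.closedBall_subset_ball (by norm_num)))
      (fun z hz => hbd z (by
        have := Metric.mem_sphere.1 hz
        rw [Metric.mem_closedBall]; linarith))
    simpa using this
  · exact hbd c (Metric.mem_closedBall_self (by norm_num))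

lemma psiC_real (t μ : ℝ) : psiC t (μ : ℂ) =
    ((∑' m : ℕ, ((-1 : ℝ) ^ (m + 1) / ((m + 1).factorial : ℝ)) * t ^ m *
      (Real.Gamma (μ + m + 2))⁻¹ : ℝ) : ℂ) := by
  rw [Complex.ofReal_tsum, psiC]
  congr 1
  ext m
  push_cast
  rw [← Complex.Gamma_ofReal]
  push_cast
  rfl

lemma besselJ_eq (μ x : ℝ) (hx : 0 < x) (hx2 : x ≤ 2) :
    besselJ μ x = (x / 2) ^ μ * ((Real.Gamma (μ + 1))⁻¹ +
      (x / 2) ^ 2 * (psiC ((x / 2) ^ 2) (μ : ℂ)).re) := by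
  obtain ⟨M, hM0, hM⟩ := gamma_inv_bound (μ : ℂ)
  set t : ℝ := (x / 2) ^ 2 with ht
  have ht0 : 0 ≤ t := by positivity
  have ht1 : t ≤ 1 := by
    rw [ht]; exact pow_le_one₀ (by linarith) (by linarith)
  have hs : Summable fun m : ℕ => M * (1 / (m.factorial : ℝ)) := by
    have := (Real.summable_pow_div_factorial 1).mul_left M
    simpa using this
  have hsum : Summable fun m : ℕ => ((-1 : ℝ) ^ (m + 1) / ((m + 1).factorial : ℝ)) * t ^ m *
      (Real.Gamma (μ + m + 2))⁻¹ := by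
    refine Summable.of_norm_bounded hs ?_
    intro m
    have := psiC_term_bound ht0 ht1 m _
      (hM m (μ : ℂ) (Metric.mem_closedBall_self (by norm_num)))
    refine le_trans (le_of_eq ?_) this
    rw [← Complex.norm_real]
    congr 1
    push_cast
    rw [← Complex.Gamma_ofReal]
    push_cast
    rfl
  have hx' : 0 < x / 2 := by linarith
  have hpow : ∀ m : ℕ, (x / 2) ^ (2 * (m : ℝ) + μ) = (x / 2) ^ μ * t ^ m := by
    intro m
    rw [Real.rpow_add hx', mul_comm, ht, ← pow_mul]
    congr 1
    rw [← Real.rpow_natCast]; push_cast; rfl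
  have hstep : ∀ m : ℕ, ((-1 : ℝ) ^ (m + 1) / ((m + 1).factorial * Real.Gamma (((m + 1 : ℕ) : ℝ) + μ + 1))) *
      (x / 2) ^ (2 * ((m + 1 : ℕ) : ℝ) + μ) = ((x / 2) ^ μ * t) *
      (((-1 : ℝ) ^ (m + 1) / ((m + 1).factorial : ℝ)) * t ^ m * (Real.Gamma (μ + m + 2))⁻¹) := by
    intro m
    rw [hpow]
    have : ((m + 1 : ℕ) : ℝ) + μ + 1 = μ + m + 2 := by push_cast; ring
    rw [this, pow_succ t, div_mul_eq_div_div, div_eq_mul_inv _ (Real.Gamma _)]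
    ring
  rw [psiC_real, Complex.ofReal_re, besselJ, Summable.tsum_eq_zero_add]
  · rw [tsum_congr hstep, tsum_mul_left, hpow]
    simp
    ring
  · rw [← summable_nat_add_iff 1]
    exact (summable_congr hstep).2 (hsum.mul_left _)

/-- Joint properties of `besselJ` near an order `c`. -/
lemma besselJ_props (c r' : ℝ) (hr : HasDerivAt (fun μ : ℝ => (Real.Gamma (μ + 1))⁻¹) r' c) :
    ∃ (p p' : ℝ → ℝ) (K : ℝ), ∀ x : ℝ, 0 < x → x ≤ 2 →
      |p x| ≤ K ∧ |p' x| ≤ K ∧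
      besselJ c x = (x / 2) ^ c * ((Real.Gamma (c + 1))⁻¹ + (x / 2) ^ 2 * p x) ∧
      HasDerivAt (fun μ => besselJ μ x)
        ((x / 2) ^ c * (Real.log (x / 2) * ((Real.Gamma (c + 1))⁻¹ + (x / 2) ^ 2 * p x) +
          (r' + (x / 2) ^ 2 * p' x))) c := by
  obtain ⟨K, hK⟩ := psiC_props (c : ℂ)
  refine ⟨fun x => (psiC ((x / 2) ^ 2) (c : ℂ)).re,
    fun x => (deriv (psiC ((x / 2) ^ 2)) (c : ℂ)).re, K, ?_⟩
  intro x hx hx2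
  obtain ⟨h1, h2, h3⟩ := hK ((x / 2) ^ 2) (by positivity)
    (pow_le_one₀ (by linarith) (by linarith))
  refine ⟨(Complex.abs_re_le_norm _).trans h3, (Complex.abs_re_le_norm _).trans h2,
    besselJ_eq c x hx hx2, ?_⟩
  have hfun : (fun μ => besselJ μ x) = fun μ : ℝ => (x / 2) ^ μ * ((Real.Gamma (μ + 1))⁻¹ +
      (x / 2) ^ 2 * (psiC ((x / 2) ^ 2) (μ : ℂ)).re) := by
    ext μ; exact besselJ_eq μ x hx hx2
  rw [hfun]
  have h := ((hasDerivAt_id c).const_rpow (show 0 < x / 2 by linarith)).mul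
    (hr.add ((h1.real_of_complex).const_mul ((x / 2) ^ 2)))
  refine h.congr_deriv ?_
  simp
  ring

instance nonint_neBot (ν : ℝ) : (𝓝[{μ : ℝ | ∀ n : ℤ, μ ≠ (n : ℝ)}] ν).NeBot := by
  rw [← mem_closure_iff_nhdsWithin_neBot]
  refine closure_mono ?_ (dense_irrational ν)
  intro x hx n
  exact Irrational.ne_int hx n

lemma small_mul_bdd {q p : ℝ → ℝ} {K : ℝ} (hq : Tendsto q (𝓝[>] (0 : ℝ)) (𝓝 0))
    (hp : ∀ x : ℝ, 0 < x → x ≤ 2 → |p x| ≤ K) :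
    Tendsto (fun x => q x * p x) (𝓝[>] (0 : ℝ)) (𝓝 0) := by
  have h : Tendsto (fun x => |q x| * K) (𝓝[>] (0 : ℝ)) (𝓝 0) := by
    simpa using hq.abs.mul_const K
  refine squeeze_zero_norm' ?_ h
  have h2 : ∀ᶠ x in 𝓝[>] (0 : ℝ), x ∈ Ioc (0 : ℝ) 2 := Ioc_mem_nhdsGT (by norm_num)
  filter_upwards [h2] with x hx
  rw [Real.norm_eq_abs, abs_mul]
  exact mul_le_mul_of_nonneg_left (hp x hx.1 hx.2) (abs_nonneg _)

lemma tendsto_half : Tendsto (fun x : ℝ => x / 2) (𝓝[>] (0 : ℝ)) (𝓝[>] (0 : ℝ)) := by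
  refine tendsto_nhdsWithin_iff.2 ⟨?_, ?_⟩
  · have : Tendsto (fun x : ℝ => x / 2) (𝓝 (0 : ℝ)) (𝓝 (0 / 2)) :=
      (continuous_id.div_const 2).tendsto 0
    rw [zero_div] at this
    exact this.mono_left nhdsWithin_le_nhds
  · filter_upwards [self_mem_nhdsWithin] with x hx
    have : (0 : ℝ) < x := hx
    exact half_pos this

lemma tendsto_half_sq : Tendsto (fun x : ℝ => (x / 2) ^ 2) (𝓝[>] (0 : ℝ)) (𝓝 0) := by
  have := (tendsto_half.mono_right nhdsWithin_le_nhds).pow 2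
  simpa using this

lemma tendsto_rpow_zero {ν : ℝ} (hν : 0 < ν) :
    Tendsto (fun x : ℝ => x ^ ν) (𝓝[>] (0 : ℝ)) (𝓝 0) := by
  have := (Real.continuousAt_rpow_const 0 ν (Or.inr hν.le)).tendsto
  rw [Real.zero_rpow hν.ne'] at this
  exact this.mono_left nhdsWithin_le_nhds

/-- The factor `a + (x/2)^2 p x` tends to `a`. -/
lemma tendsto_factor (a : ℝ) {p : ℝ → ℝ} {K : ℝ} (hp : ∀ x : ℝ, 0 < x → x ≤ 2 → |p x| ≤ K) :
    Tendsto (fun x => a + (x / 2) ^ 2 * p x) (𝓝[>] (0 : ℝ)) (𝓝 a) := by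
  simpa using (small_mul_bdd tendsto_half_sq hp).const_add a

lemma tendsto_log_factor {p : ℝ → ℝ} {K : ℝ} (hp : ∀ x : ℝ, 0 < x → x ≤ 2 → |p x| ≤ K) :
    Tendsto (fun x => Real.log (x / 2) * (x / 2) ^ 2 * p x) (𝓝[>] (0 : ℝ)) (𝓝 0) := by
  refine small_mul_bdd ?_ hp
  have := (tendsto_log_mul_rpow_nhdsGT_zero (r := 2) (by norm_num)).comp tendsto_half
  refine this.congr ?_
  intro x
  simp

lemma hasDerivAt_r {c : ℝ} (hc : ∀ m : ℕ, c + 1 ≠ -m) :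
    ∃ r', HasDerivAt (fun μ : ℝ => (Real.Gamma (μ + 1))⁻¹) r' c := by
  have h1 : DifferentiableAt ℝ (fun μ : ℝ => Real.Gamma (μ + 1)) c :=
    DifferentiableAt.comp (g := Real.Gamma) c (Real.differentiableAt_Gamma hc) (by fun_prop)
  exact ⟨_, (h1.inv (Real.Gamma_ne_zero hc)).hasDerivAt⟩

lemma hasDerivAt_r_neg {n : ℕ} (hn : 0 < n) :
    HasDerivAt (fun μ : ℝ => (Real.Gamma (μ + 1))⁻¹) (-(-1) ^ n * Real.Gamma n) (-(n : ℝ)) := by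
  have hn' : (0 : ℝ) < n := by exact_mod_cast hn
  have hG : DifferentiableAt ℝ (fun μ : ℝ => Real.Gamma (-μ)) (-(n : ℝ)) := by
    have : DifferentiableAt ℝ Real.Gamma (-(-(n : ℝ))) := by
      rw [neg_neg]
      refine Real.differentiableAt_Gamma ?_
      intro m hm
      have : (0 : ℝ) ≤ m := Nat.cast_nonneg m
      linarith
    exact this.comp _ (by fun_prop)
  have hev : (fun μ : ℝ => (Real.Gamma (μ + 1))⁻¹) =ᶠ[𝓝 (-(n : ℝ))]
      fun μ => Real.Gamma (-μ) * (Real.sin (π * (μ + 1)) / π) := by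
    filter_upwards [Iio_mem_nhds (show -(n : ℝ) < 0 by linarith)] with μ hμ
    have h0 : Real.Gamma (-μ) ≠ 0 := (Real.Gamma_pos_of_pos (by linarith [show μ < 0 from hμ])).ne'
    have h := Real.Gamma_mul_Gamma_one_sub (μ + 1)
    have h2 : 1 - (μ + 1) = -μ := by ring
    rw [h2] at h
    have h3 : Real.Gamma (μ + 1) = π / Real.sin (π * (μ + 1)) / Real.Gamma (-μ) := by
      rw [← h]; field_simp
    rw [h3, inv_div, div_div_eq_mul_div, mul_div_assoc]
  have hs : HasDerivAt (fun μ : ℝ => Real.sin (π * (μ + 1)) / π)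
      (Real.cos (π * (-(n : ℝ) + 1)) * π / π) (-(n : ℝ)) := by
    have h1 : HasDerivAt (fun μ : ℝ => π * (μ + 1)) π (-(n : ℝ)) := by
      simpa using ((hasDerivAt_id (-(n : ℝ))).add_const 1).const_mul π
    exact (h1.sin).div_const π
  have hm := hG.hasDerivAt.mul hs
  refine (hm.congr_of_eventuallyEq hev).congr_deriv ?_
  have e1 : Real.sin (π * (-(n : ℝ) + 1)) = 0 := by
    have : π * (-(n : ℝ) + 1) = ((1 - n : ℤ) : ℝ) * π := by push_cast; ring
    rw [this, Real.sin_int_mul_pi]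
  have e2 : Real.cos (π * (-(n : ℝ) + 1)) = -(-1) ^ n := by
    have : π * (-(n : ℝ) + 1) = π - n * π := by ring
    rw [this, Real.cos_pi_sub, Real.cos_nat_mul_pi]
  rw [e1, e2, neg_neg]
  field_simp
  ring

lemma besselJ_tendsto {ν : ℝ} (hν : 0 < ν) :
    Tendsto (fun x : ℝ => x ^ ν * besselJ ν x) (𝓝[>] (0 : ℝ)) (𝓝 0) := by
  obtain ⟨r', hr⟩ := hasDerivAt_r (c := ν) (fun m h => by
    have : (0 : ℝ) ≤ m := Nat.cast_nonneg m
    linarith)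
  obtain ⟨p, p', K, h⟩ := besselJ_props ν r' hr
  have h1 := (tendsto_rpow_zero hν).mul (((tendsto_rpow_zero hν).comp tendsto_half).mul
    (tendsto_factor (Real.Gamma (ν + 1))⁻¹ (fun x hx hx2 => (h x hx hx2).1)))
  simp only [zero_mul] at h1
  refine h1.congr' ?_
  have h2 : ∀ᶠ x in 𝓝[>] (0 : ℝ), x ∈ Ioc (0 : ℝ) 2 := Ioc_mem_nhdsGT (by norm_num)
  filter_upwards [h2] with x hx
  rw [(h x hx.1 hx.2).2.2.1]
  rfl

lemma rpow_cancel {x : ℝ} (hx : 0 < x) (ν : ℝ) : x ^ ν * (x / 2) ^ (-ν) = 2 ^ ν := by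
  have h := (Real.rpow_pos_of_pos hx ν).ne'
  have h' := (Real.rpow_pos_of_pos (show (0 : ℝ) < 2 by norm_num) ν).ne'
  rw [Real.rpow_neg (by linarith), Real.div_rpow hx.le (by norm_num)]
  field_simp

lemma besselY_tendsto_nonint {ν : ℝ} (hν : 0 < ν) (hi : ∀ n : ℤ, ν ≠ n) :
    Tendsto (fun x : ℝ => x ^ ν * besselY ν x) (𝓝[>] (0 : ℝ))
      (𝓝 (-(Real.Gamma ν * 2 ^ ν / π))) := by
  obtain ⟨r1, hr1⟩ := hasDerivAt_r (c := ν) (fun m h => hi (-m - 1) (by push_cast; linarith))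
  obtain ⟨r2, hr2⟩ := hasDerivAt_r (c := -ν) (fun m h => hi (m + 1) (by push_cast; linarith))
  obtain ⟨p1, p1', K1, h1⟩ := besselJ_props ν r1 hr1
  obtain ⟨p2, p2', K2, h2⟩ := besselJ_props (-ν) r2 hr2
  have hsin : Real.sin (ν * π) ≠ 0 := by
    intro h
    obtain ⟨n, hn⟩ := Real.sin_eq_zero_iff.1 h
    exact hi n (mul_right_cancel₀ Real.pi_ne_zero hn).symm
  have hY : ∀ x : ℝ, 0 < x → x ≤ 2 → besselY ν x =
      (besselJ ν x * Real.cos (ν * π) - besselJ (-ν) x) / Real.sin (ν * π) := by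
    intro x hx hx2
    refine Filter.Tendsto.limUnder_eq ?_
    have c1 : ContinuousAt (fun μ => besselJ μ x) ν := (h1 x hx hx2).2.2.2.continuousAt
    have c2 : ContinuousAt (fun μ => besselJ (-μ) x) ν :=
      ContinuousAt.comp (g := fun μ => besselJ μ x) (h2 x hx hx2).2.2.2.continuousAt
        continuous_neg.continuousAt
    have : ContinuousAt (fun μ : ℝ =>
        (besselJ μ x * Real.cos (μ * π) - besselJ (-μ) x) / Real.sin (μ * π)) ν := by
      refine ContinuousAt.div ((c1.mul ?_).sub c2) ?_ hsin
      · exact (by fun_prop : Continuous fun μ : ℝ => Real.cos (μ * π)).continuousAt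
      · exact (by fun_prop : Continuous fun μ : ℝ => Real.sin (μ * π)).continuousAt
    exact this.tendsto.mono_left nhdsWithin_le_nhds
  have hl := (((besselJ_tendsto hν).mul_const (Real.cos (ν * π))).sub
    ((tendsto_factor (Real.Gamma (-ν + 1))⁻¹ (fun x hx hx2 => (h2 x hx hx2).1)).const_mul
      ((2 : ℝ) ^ ν))).div_const (Real.sin (ν * π))
  have hval : (0 * Real.cos (ν * π) - 2 ^ ν * (Real.Gamma (-ν + 1))⁻¹) / Real.sin (ν * π)
      = -(Real.Gamma ν * 2 ^ ν / π) := by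
    have h := Real.Gamma_mul_Gamma_one_sub ν
    have hG : Real.Gamma (1 - ν) ≠ 0 :=
      Real.Gamma_ne_zero (fun m h => hi (m + 1) (by push_cast; linarith))
    have e : -ν + 1 = 1 - ν := by ring
    have e' : Real.Gamma ν = π / Real.sin (ν * π) / Real.Gamma (1 - ν) := by
      rw [mul_comm ν π, ← h]; field_simp
    rw [e, e']
    have := Real.pi_ne_zero
    field_simp
    ring
  rw [hval] at hl
  refine hl.congr' ?_
  have h3 : ∀ᶠ x in 𝓝[>] (0 : ℝ), x ∈ Ioc (0 : ℝ) 2 := Ioc_mem_nhdsGT (by norm_num)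
  filter_upwards [h3] with x hx
  rw [hY x hx.1 hx.2, (h2 x hx.1 hx.2).2.2.1, ← rpow_cancel hx.1 ν]
  ring

lemma besselJ_neg_nat (n : ℕ) (x : ℝ) (hx : 0 < x) :
    besselJ (-(n : ℝ)) x = (-1) ^ n * besselJ n x := by
  have hx' : 0 < x / 2 := by linarith
  rw [besselJ, besselJ, ← tsum_mul_left]
  have hinj : Function.Injective (fun m : ℕ => m + n) := add_left_injective n
  rw [← hinj.tsum_eq]
  · refine tsum_congr fun m => ?_
    have e1 : ((m + n : ℕ) : ℝ) + -(n : ℝ) + 1 = m + 1 := by push_cast; ring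
    have e2 : 2 * ((m + n : ℕ) : ℝ) + -(n : ℝ) = 2 * m + n := by push_cast; ring
    have e3 : (m : ℝ) + n + 1 = ((m + n : ℕ) : ℝ) + 1 := by push_cast; ring
    rw [e1, e2, e3, Real.Gamma_nat_eq_factorial, Real.Gamma_nat_eq_factorial, pow_add]
    ring
  · intro m hm
    by_contra hcon
    apply hm
    have hmn : m < n := by
      by_contra hge
      exact hcon ⟨m - n, by simp; omega⟩
    have : Real.Gamma ((m : ℝ) + -(n : ℝ) + 1) = 0 := by
      rw [Real.Gamma_eq_zero_iff]
      refine ⟨n - m - 1, ?_⟩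
      have : ((n - m - 1 : ℕ) : ℝ) = n - m - 1 := by
        rw [Nat.cast_sub (by omega), Nat.cast_sub (by omega)]; simp
      rw [this]; ring
    simp [this]

lemma besselY_tendsto_nat {n : ℕ} (hn : 0 < n) :
    Tendsto (fun x : ℝ => x ^ (n : ℝ) * besselY n x) (𝓝[>] (0 : ℝ))
      (𝓝 (-(Real.Gamma n * 2 ^ (n : ℝ) / π))) := by
  have hn' : (0 : ℝ) < n := by exact_mod_cast hn
  obtain ⟨r1, hr1⟩ := hasDerivAt_r (c := (n : ℝ)) (fun m h => by
    have : (0 : ℝ) ≤ m := Nat.cast_nonneg m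
    linarith)
  obtain ⟨p1, p1', K1, h1⟩ := besselJ_props n r1 hr1
  obtain ⟨p2, p2', K2, h2⟩ := besselJ_props (-(n : ℝ)) _ (hasDerivAt_r_neg hn)
  have hG0 : (Real.Gamma (-(n : ℝ) + 1))⁻¹ = 0 := by
    rw [inv_eq_zero, Real.Gamma_eq_zero_iff]
    refine ⟨n - 1, ?_⟩
    rw [Nat.cast_sub (by omega)]; push_cast; ring
  rw [hG0] at h2
  have hpi := Real.pi_ne_zero
  have hsq : ((-1 : ℝ) ^ n) * (-1) ^ n = 1 := by
    rw [← mul_pow]; simp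
  have hcos : Real.cos (n * π) = (-1) ^ n := Real.cos_nat_mul_pi n
  have hsin : Real.sin (n * π) = 0 := Real.sin_nat_mul_pi n
  have hY : ∀ x : ℝ, 0 < x → x ≤ 2 → besselY n x =
      (((x / 2) ^ (n : ℝ) * (Real.log (x / 2) * ((Real.Gamma (n + 1))⁻¹ + (x / 2) ^ 2 * p1 x) +
          (r1 + (x / 2) ^ 2 * p1' x))) * (-1) ^ n +
        ((x / 2) ^ (-(n : ℝ)) * (Real.log (x / 2) * (0 + (x / 2) ^ 2 * p2 x) +
          (-(-1) ^ n * Real.Gamma n + (x / 2) ^ 2 * p2' x)))) / ((-1) ^ n * π) := by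
    intro x hx hx2
    refine Filter.Tendsto.limUnder_eq ?_
    have d1 := (h1 x hx hx2).2.2.2
    have d2 := (h2 x hx hx2).2.2.2
    have d2' := HasDerivAt.comp (h₂ := fun μ => besselJ μ x) (n : ℝ) d2 (hasDerivAt_neg (n : ℝ))
    have dl : HasDerivAt (fun μ : ℝ => μ * π) π (n : ℝ) := by
      simpa using (hasDerivAt_id (n : ℝ)).mul_const π
    have dnum := (d1.mul dl.cos).sub d2'
    have dden := dl.sin
    have t1 := hasDerivAt_iff_tendsto_slope.1 dnum
    have t2 := hasDerivAt_iff_tendsto_slope.1 dden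
    have hne : Real.cos (n * π) * π ≠ 0 := by
      rw [hcos]; exact mul_ne_zero (pow_ne_zero _ (by norm_num)) hpi
    have t := t1.div t2 hne
    have hsub : {μ : ℝ | ∀ k : ℤ, μ ≠ (k : ℝ)} ⊆ {(n : ℝ)}ᶜ := by
      intro μ hμ h
      exact hμ n (by simpa using h)
    have t' := t.mono_left (nhdsWithin_mono (n : ℝ) hsub)
    rw [hcos, hsin] at t'
    have hJ := besselJ_neg_nat n x hx
    refine (t'.congr' ?_).trans (le_of_eq ?_)
    · filter_upwards [self_mem_nhdsWithin] with μ hμ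
      have hμn : μ - n ≠ 0 := sub_ne_zero.2 (hsub hμ)
      simp only [Pi.div_apply, slope_def_field, Pi.mul_apply, Pi.sub_apply, Function.comp_apply]
      rw [hcos, hsin, hJ, div_div_div_cancel_right₀ hμn]
      congr 1 <;> ring
    · congr 1
      ring
  have l1 : Tendsto (fun x : ℝ => Real.log (x / 2) * (x / 2) ^ (n : ℝ)) (𝓝[>] (0 : ℝ)) (𝓝 0) :=
    (tendsto_log_mul_rpow_nhdsGT_zero hn').comp tendsto_half
  have l2 := (tendsto_rpow_zero hn').comp tendsto_half
  have A := (tendsto_rpow_zero hn').mul ((l1.mul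
      (tendsto_factor (Real.Gamma (n + 1))⁻¹ (fun x hx hx2 => (h1 x hx hx2).1))).add
    (l2.mul (tendsto_factor r1 (fun x hx hx2 => (h1 x hx hx2).2.1))))
  have B := ((tendsto_log_factor (fun x hx hx2 => (h2 x hx hx2).1)).add
    (tendsto_factor (-(-1) ^ n * Real.Gamma n) (fun x hx hx2 => (h2 x hx hx2).2.1))).const_mul
      ((2 : ℝ) ^ (n : ℝ))
  have T := ((A.mul_const ((-1 : ℝ) ^ n)).add B).div_const ((-1) ^ n * π)
  have hm1 : ((-1 : ℝ) ^ n) ≠ 0 := pow_ne_zero _ (by norm_num)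
  refine (T.congr' ?_).trans (le_of_eq ?_)
  · have h3 : ∀ᶠ x in 𝓝[>] (0 : ℝ), x ∈ Ioc (0 : ℝ) 2 := Ioc_mem_nhdsGT (by norm_num)
    filter_upwards [h3] with x hx
    rw [hY x hx.1 hx.2, ← rpow_cancel hx.1 n]
    simp only [Function.comp_apply]
    ring
  · congr 1
    simp only [zero_mul, mul_zero, zero_add]
    field_simp

/-- Behaviour of the cylinder function at the origin: for `ν > 0`,
`x^ν · C_ν(x) → sin δ · Γ(ν) 2^ν / π` as `x → 0⁺`, i.e.
`C_ν(x) = sin δ (Γ(ν) 2^ν/π + o(1)) x^{−ν}` as `x → 0⁺`. -/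
theorem cylinder_tendsto_zero_right (δ ν : ℝ) (hν : 0 < ν) :
    Tendsto (fun x : ℝ => x ^ ν * cylinder δ ν x) (𝓝[>] (0 : ℝ))
      (𝓝 (Real.sin δ * (Real.Gamma ν * 2 ^ ν / π))) := by
  have hY : Tendsto (fun x : ℝ => x ^ ν * besselY ν x) (𝓝[>] (0 : ℝ))
      (𝓝 (-(Real.Gamma ν * 2 ^ ν / π))) := by
    by_cases hi : ∀ n : ℤ, ν ≠ n
    · exact besselY_tendsto_nonint hν hi
    · push Not at hi
      obtain ⟨k, rfl⟩ := hi
      have hk : 0 < k := by exact_mod_cast hν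
      lift k to ℕ using hk.le
      have := besselY_tendsto_nat (n := k) (by exact_mod_cast hk)
      simpa using this
  have h := ((besselJ_tendsto hν).const_mul (Real.cos δ)).sub (hY.const_mul (Real.sin δ))
  refine (h.congr ?_).trans (le_of_eq ?_)
  · intro x
    rw [cylinder]
    ring
  · congr 1
    ring
end
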